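/- The 𝕂-algebra homomorphism ι : 𝔇_n → 𝒟_n defined by ι(E_i) = Σ_{r=−i}^{i−1} w_i^r, ι(F_{θ(i)}) = Σ_{r=−i}^{i−1} m_i^r, ι(K_i) = q^{2i} X_{V_{i,−i}} ⋯ X_{V_{i,i}}, ι(K'_{θ(i)}) = q^{2i} X_{Λ_{i,−i}} ⋯ X_{Λ_{i,i}} is injective. -/

import Mathlib

noncomputable section

/-- The ground field `𝕂 = ℂ(q)`, the field of rational functions over `ℂ`. -/
abbrev Kq : Type := RatFunc ℂ

/-- The formal variable `q ∈ ℂ(q)`. -/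
def qq : Kq := RatFunc.X

/-- `𝐢 = √−1 ∈ ℂ`, viewed as a constant in `𝕂 = ℂ(q)`. -/
def ii : Kq := RatFunc.C Complex.I

/-- `θ(i) = n + 1 − i`. -/
def th (n : ℕ) (i : ℤ) : ℤ := (n : ℤ) + 1 - i

/-- Labels for the vertices of the `𝒟ₙ`-quiver: `V i r` stands for `V_{i,r}`
(the canonical labels), and `C i` stands for the central vertex `Λ_{i,0}`. -/
inductive DnLabel : Type
  | V : ℤ → ℤ → DnLabel
  | C : ℤ → DnLabel
deriving DecidableEq

/-- Validity of a label for given rank `n`: `V i r` requires `1 ≤ i ≤ n`, `−i ≤ r ≤ i`;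
`C i` requires `1 ≤ i ≤ n`.  There are `n² + 3n` valid labels. -/
def DnLabel.valid (n : ℕ) : DnLabel → Prop
  | .V i r => 1 ≤ i ∧ i ≤ (n : ℤ) ∧ -i ≤ r ∧ r ≤ i
  | .C i => 1 ≤ i ∧ i ≤ (n : ℤ)

instance (n : ℕ) (v : DnLabel) : Decidable (v.valid n) := by
  cases v <;> unfold DnLabel.valid <;> infer_instance

/-- The vertex set of the `𝒟ₙ`-quiver. -/
def DnVertex (n : ℕ) := {v : DnLabel // v.valid n}

/-- The canonical label of the vertex `Λ_{i,r}`, using the identifications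
`Λ_{a,b} = V_{θ(b),−θ(a)}` for `b > 0` and `Λ_{a,b} = V_{θ(−b),θ(a)}` for `b < 0`. -/
def Lam (n : ℕ) (i r : ℤ) : DnLabel :=
  if 0 < r then .V (th n r) (-(th n i))
  else if r < 0 then .V (th n (-r)) (th n i)
  else .C i

/-- The list of arrows `(source, target, doubled weight)` of the `𝒟ₙ`-quiver, obtained by
amalgamating two copies of the Fock–Goncharov `(n+1)`-triangle quiver along two pairs of
sides.  Solid (weight `1`) arrows get doubled weight `2`, dashed (weight `1/2`) arrows get
doubled weight `1`.  The families are: the horizontal `V_i`- and `Λ_i`-path arrows, the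
dashed boundary arrows along the two frozen columns, and, for each `1 ≤ i < n`, the
oriented cycle `V_{i,0} → V_{i+1,−1} → ⋯ → V_{n,i−n} → Λ_{i,0} → V_{n,n−i} → ⋯ → V_{i+1,1} → V_{i,0}`
through the central column. -/
def dnArrows (n : ℕ) : List (DnLabel × DnLabel × ℤ) :=
  ((List.range n).flatMap fun i0 =>
    (List.range (2 * i0 + 2)).map fun k =>
      (DnLabel.V ((i0 : ℤ) + 1) (-((i0 : ℤ) + 1) + k),
       DnLabel.V ((i0 : ℤ) + 1) (-((i0 : ℤ) + 1) + k + 1), 2))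
  ++ ((List.range n).flatMap fun i0 =>
    (List.range (2 * i0 + 2)).map fun k =>
      (Lam n ((i0 : ℤ) + 1) (-((i0 : ℤ) + 1) + k),
       Lam n ((i0 : ℤ) + 1) (-((i0 : ℤ) + 1) + k + 1), 2))
  ++ ((List.range (n - 1)).map fun i0 =>
      (DnLabel.V ((i0 : ℤ) + 1) (-((i0 : ℤ) + 1)),
       DnLabel.V ((i0 : ℤ) + 2) (-((i0 : ℤ) + 2)), 1))
  ++ ((List.range (n - 1)).map fun i0 =>
      (DnLabel.V ((i0 : ℤ) + 2) ((i0 : ℤ) + 2),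
       DnLabel.V ((i0 : ℤ) + 1) ((i0 : ℤ) + 1), 1))
  ++ ((List.range (n - 1)).flatMap fun i0 =>
      (((List.range (n - 1 - i0)).map fun k =>
          (DnLabel.V ((i0 : ℤ) + 1 + k) (-(k : ℤ)),
           DnLabel.V ((i0 : ℤ) + 2 + k) (-(k : ℤ) - 1), 2))
        ++ [(DnLabel.V (n : ℤ) ((i0 : ℤ) + 1 - n), DnLabel.C ((i0 : ℤ) + 1), 2),
            (DnLabel.C ((i0 : ℤ) + 1), DnLabel.V (n : ℤ) ((n : ℤ) - (i0 + 1)), 2)]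
        ++ ((List.range (n - 1 - i0)).map fun k =>
          (DnLabel.V ((i0 : ℤ) + 2 + k) ((k : ℤ) + 1),
           DnLabel.V ((i0 : ℤ) + 1 + k) (k : ℤ), 2))))

/-- The doubled exchange matrix `2·ε_{uv}` of the `𝒟ₙ`-quiver. -/
def eps2 (n : ℕ) (u v : DnLabel) : ℤ :=
  ((dnArrows n).map fun a =>
    (if a.1 = u ∧ a.2.1 = v then a.2.2 else 0)
      - (if a.1 = v ∧ a.2.1 = u then a.2.2 else 0)).sum

/-- The defining relations of the quantum torus algebra `𝒟ₙ`: generators `X_v^{±1}`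
(`Sum.inl v` is `X_v`, `Sum.inr v` is `X_v⁻¹`) with `X_u X_v = q^{2 ε_{vu}} X_v X_u`. -/
inductive DnRel (n : ℕ) :
    FreeAlgebra Kq (DnVertex n ⊕ DnVertex n) →
      FreeAlgebra Kq (DnVertex n ⊕ DnVertex n) → Prop
  | comm (u v : DnVertex n) :
      DnRel n (FreeAlgebra.ι Kq (Sum.inl u) * FreeAlgebra.ι Kq (Sum.inl v))
        ((qq ^ eps2 n v.1 u.1) • (FreeAlgebra.ι Kq (Sum.inl v) * FreeAlgebra.ι Kq (Sum.inl u)))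
  | mul_inv (v : DnVertex n) :
      DnRel n (FreeAlgebra.ι Kq (Sum.inl v) * FreeAlgebra.ι Kq (Sum.inr v)) 1
  | inv_mul (v : DnVertex n) :
      DnRel n (FreeAlgebra.ι Kq (Sum.inr v) * FreeAlgebra.ι Kq (Sum.inl v)) 1

/-- The quantum torus algebra `𝒟ₙ`. -/
abbrev Dtorus (n : ℕ) := RingQuot (DnRel n)

/-- The cluster variable `X_v ∈ 𝒟ₙ` attached to a label (junk value `1` on invalid labels). -/
def Xg (n : ℕ) (v : DnLabel) : Dtorus n :=
  if h : v.valid n then RingQuot.mkAlgHom Kq (DnRel n) (FreeAlgebra.ι Kq (Sum.inl ⟨v, h⟩)) else 1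

/-- The inverse cluster variable `X_v⁻¹ ∈ 𝒟ₙ` (junk value `1` on invalid labels). -/
def Xinv (n : ℕ) (v : DnLabel) : Dtorus n :=
  if h : v.valid n then RingQuot.mkAlgHom Kq (DnRel n) (FreeAlgebra.ι Kq (Sum.inr ⟨v, h⟩)) else 1

/-- The ordered product `X_{V_{i,−i}} X_{V_{i,1−i}} ⋯ X_{V_{i,r}}`. -/
def Vprod (n : ℕ) (i r : ℤ) : Dtorus n :=
  ((List.range (r + i + 1).toNat).map fun k => Xg n (.V i (-i + k))).prod

/-- The ordered product `X_{Λ_{i,−i}} X_{Λ_{i,1−i}} ⋯ X_{Λ_{i,r}}`. -/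
def Lprod (n : ℕ) (i r : ℤ) : Dtorus n :=
  ((List.range (r + i + 1).toNat).map fun k => Xg n (Lam n i (-i + k))).prod

/-- `w_i^r = 𝐢 q^{i+r} X_{V_{i,−i}} X_{V_{i,1−i}} ⋯ X_{V_{i,r}}`. -/
def ww (n : ℕ) (i r : ℤ) : Dtorus n := (ii * qq ^ (i + r)) • Vprod n i r

/-- `m_i^r = 𝐢 q^{i+r} X_{Λ_{i,−i}} X_{Λ_{i,1−i}} ⋯ X_{Λ_{i,r}}`. -/
def mm (n : ℕ) (i r : ℤ) : Dtorus n := (ii * qq ^ (i + r)) • Lprod n i r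


/-- Index set `{1, …, n} ⊂ ℤ`. -/
def Idx (n : ℕ) := {i : ℤ // 1 ≤ i ∧ i ≤ (n : ℤ)}

/-- `θ` as a map on the index set. -/
def thIdx (n : ℕ) (i : Idx n) : Idx n :=
  ⟨th n i.1, by obtain ⟨h1, h2⟩ := i.2; unfold th; constructor <;> omega⟩

/-- Generators of the Drinfeld double `𝔇ₙ`. -/
inductive DDGen (n : ℕ) : Type
  | E : Idx n → DDGen n
  | F : Idx n → DDGen n
  | K : Idx n → DDGen n
  | K' : Idx n → DDGen n
  | Kinv : Idx n → DDGen n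
  | K'inv : Idx n → DDGen n

/-- The Cartan matrix of type `Aₙ`. -/
def cartanA (i j : ℤ) : ℤ := if i = j then 2 else if (i - j).natAbs = 1 then -1 else 0

/-- Shorthand for the generators inside the free algebra. -/
def ddg (n : ℕ) (g : DDGen n) : FreeAlgebra Kq (DDGen n) := FreeAlgebra.ι Kq g

/-- The defining relations of the Drinfeld double `𝔇ₙ`. -/
inductive DDRel (n : ℕ) : FreeAlgebra Kq (DDGen n) → FreeAlgebra Kq (DDGen n) → Prop
  | KE (i j : Idx n) : DDRel n (ddg n (.K i) * ddg n (.E j))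
      ((qq ^ cartanA i.1 j.1) • (ddg n (.E j) * ddg n (.K i)))
  | K'E (i j : Idx n) : DDRel n (ddg n (.K' i) * ddg n (.E j))
      ((qq ^ (-cartanA i.1 j.1)) • (ddg n (.E j) * ddg n (.K' i)))
  | KF (i j : Idx n) : DDRel n (ddg n (.K i) * ddg n (.F j))
      ((qq ^ (-cartanA i.1 j.1)) • (ddg n (.F j) * ddg n (.K i)))
  | K'F (i j : Idx n) : DDRel n (ddg n (.K' i) * ddg n (.F j))
      ((qq ^ cartanA i.1 j.1) • (ddg n (.F j) * ddg n (.K' i)))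
  | KK (i j : Idx n) : DDRel n (ddg n (.K i) * ddg n (.K j)) (ddg n (.K j) * ddg n (.K i))
  | KK' (i j : Idx n) : DDRel n (ddg n (.K i) * ddg n (.K' j)) (ddg n (.K' j) * ddg n (.K i))
  | K'K' (i j : Idx n) : DDRel n (ddg n (.K' i) * ddg n (.K' j)) (ddg n (.K' j) * ddg n (.K' i))
  | K_Kinv (i : Idx n) : DDRel n (ddg n (.K i) * ddg n (.Kinv i)) 1
  | Kinv_K (i : Idx n) : DDRel n (ddg n (.Kinv i) * ddg n (.K i)) 1
  | K'_K'inv (i : Idx n) : DDRel n (ddg n (.K' i) * ddg n (.K'inv i)) 1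
  | K'inv_K' (i : Idx n) : DDRel n (ddg n (.K'inv i) * ddg n (.K' i)) 1
  | EF (i j : Idx n) : DDRel n (ddg n (.E i) * ddg n (.F j))
      (ddg n (.F j) * ddg n (.E i)
        + (if i.1 = j.1 then qq - qq⁻¹ else 0) • (ddg n (.K i) - ddg n (.K' i)))
  | serreE (i j : Idx n) (h : (i.1 - j.1).natAbs = 1) :
      DDRel n (ddg n (.E i) * ddg n (.E i) * ddg n (.E j)
          + ddg n (.E j) * (ddg n (.E i) * ddg n (.E i)))
        ((qq + qq⁻¹) • (ddg n (.E i) * ddg n (.E j) * ddg n (.E i)))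
  | serreF (i j : Idx n) (h : (i.1 - j.1).natAbs = 1) :
      DDRel n (ddg n (.F i) * ddg n (.F i) * ddg n (.F j)
          + ddg n (.F j) * (ddg n (.F i) * ddg n (.F i)))
        ((qq + qq⁻¹) • (ddg n (.F i) * ddg n (.F j) * ddg n (.F i)))
  | EEc (i j : Idx n) (h : 1 < (i.1 - j.1).natAbs) :
      DDRel n (ddg n (.E i) * ddg n (.E j)) (ddg n (.E j) * ddg n (.E i))
  | FFc (i j : Idx n) (h : 1 < (i.1 - j.1).natAbs) :
      DDRel n (ddg n (.F i) * ddg n (.F j)) (ddg n (.F j) * ddg n (.F i))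

/-- The Drinfeld double `𝔇ₙ` of the quantum Borel subalgebra of `U_q(sl_{n+1})`. -/
abbrev DDalg (n : ℕ) := RingQuot (DDRel n)

/-- The generators of `𝔇ₙ`. -/
def DDgen (n : ℕ) (g : DDGen n) : DDalg n := RingQuot.mkAlgHom Kq (DDRel n) (ddg n g)

/-- The defining property of the embedding `ι : 𝔇ₙ → 𝒟ₙ`:
`ι(E_i) = Σ_{r=−i}^{i−1} w_i^r`, `ι(K_i) = q^{2i} X_{V_{i,−i}} ⋯ X_{V_{i,i}}`,
`ι(F_{θ(i)}) = Σ_{r=−i}^{i−1} m_i^r`, `ι(K'_{θ(i)}) = q^{2i} X_{Λ_{i,−i}} ⋯ X_{Λ_{i,i}}`,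
and `K_i^{−1}`, `(K_i')^{−1}` are sent to the inverses of the images of `K_i`, `K_i'`. -/
def iotaSpec (n : ℕ) (f : DDalg n →ₐ[Kq] Dtorus n) : Prop :=
  ∀ i : Idx n,
    f (DDgen n (.E i)) = ∑ r ∈ Finset.Icc (-i.1) (i.1 - 1), ww n i.1 r ∧
    f (DDgen n (.K i)) = (qq ^ (2 * i.1)) • Vprod n i.1 i.1 ∧
    f (DDgen n (.F (thIdx n i))) = ∑ r ∈ Finset.Icc (-i.1) (i.1 - 1), mm n i.1 r ∧
    f (DDgen n (.K' (thIdx n i))) = (qq ^ (2 * i.1)) • Lprod n i.1 i.1 ∧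
    f (DDgen n (.Kinv i)) * f (DDgen n (.K i)) = 1 ∧
    f (DDgen n (.K i)) * f (DDgen n (.Kinv i)) = 1 ∧
    f (DDgen n (.K'inv i)) * f (DDgen n (.K' i)) = 1 ∧
    f (DDgen n (.K' i)) * f (DDgen n (.K'inv i)) = 1

section QuantumSerre

variable {k A : Type*} [Field k] [Ring A] [Algebra k A]

/-- A sequence satisfying the quantum Serre relations of type `A_∞`. -/
structure IsSerreSeq (q : k) (e : ℕ → A) : Prop where
  comm : ∀ i j, i + 1 < j → Commute (e i) (e j)
  serre_succ : ∀ i, e i * e i * e (i + 1) + e (i + 1) * (e i * e i)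
    = (q + q⁻¹) • (e i * e (i + 1) * e i)
  serre_pred : ∀ i, e (i + 1) * e (i + 1) * e i + e i * (e (i + 1) * e (i + 1))
    = (q + q⁻¹) • (e (i + 1) * e i * e (i + 1))

/-- The quantum root vector attached to the interval `[j, j + t]`. -/
def rootVec (q : k) (e : ℕ → A) (j : ℕ) : ℕ → A
  | 0 => e j
  | t + 1 => rootVec q e j t * e (j + t + 1) - q • (e (j + t + 1) * rootVec q e j t)

lemma commute_qcomm {x y z : A} (q : k) (hx : Commute z x) (hy : Commute z y) :
    Commute z (x * y - q • (y * x)) :=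
  (hx.mul_right hy).sub_right ((hy.mul_right hx).smul_right q)

lemma qcomm_of_serre {q : k} (hq : q ≠ 0) {y b : A}
    (h : b * b * y + y * (b * b) = (q + q⁻¹) • (b * y * b)) :
    (y * b - q • (b * y)) * b = q⁻¹ • (b * (y * b - q • (b * y))) := by
  simp only [mul_sub, sub_mul, smul_mul_assoc, mul_smul_comm, mul_assoc, smul_sub] at h ⊢
  linear_combination (norm := skip) h
  match_scalars <;> field_simp <;> ring

lemma qcomm_of_serre' {q : k} (hq : q ≠ 0) {y b : A}
    (h : y * y * b + b * (y * y) = (q + q⁻¹) • (y * b * y)) :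
    y * (y * b - q • (b * y)) = q⁻¹ • ((y * b - q • (b * y)) * y) := by
  simp only [mul_sub, sub_mul, smul_mul_assoc, mul_smul_comm, mul_assoc, smul_sub] at h ⊢
  linear_combination (norm := skip) h
  match_scalars <;> field_simp <;> ring

lemma serre_qcomm {q : k} {y b c : A} (hy : Commute b y)
    (h : b * b * c + c * (b * b) = (q + q⁻¹) • (b * c * b)) :
    b * b * (y * c - q • (c * y)) + (y * c - q • (c * y)) * (b * b)
      = (q + q⁻¹) • (b * (y * c - q • (c * y)) * b) := by
  have h1 := congrArg (y * ·) h
  have h2 := congrArg (· * y) h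
  have e1 : ∀ z, y * (b * z) = b * (y * z) := fun z => hy.symm.left_comm z
  have e2 : y * b = b * y := hy.symm.eq
  simp only [mul_sub, sub_mul, smul_mul_assoc, mul_smul_comm, mul_assoc, smul_sub, mul_add,
    add_mul, e1, e2] at h1 h2 ⊢
  linear_combination (norm := module) h1 - q • h2

/-- The middle generator commutes with a root vector of length three. -/
lemma commute_qcomm_qcomm {q : k} (hq : q ≠ 0) (hq2 : q + q⁻¹ ≠ 0) {a b c : A} (hac : Commute a c)
    (ha : b * b * a + a * (b * b) = (q + q⁻¹) • (b * a * b))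
    (hc : b * b * c + c * (b * b) = (q + q⁻¹) • (b * c * b)) :
    Commute b ((a * b - q • (b * a)) * c - q • (c * (a * b - q • (b * a)))) := by
  have h1 := congrArg (c * ·) ha
  have h2 := congrArg (· * c) ha
  have h3 := congrArg (a * ·) hc
  have h4 := congrArg (· * a) hc
  have e1 : ∀ z, a * (c * z) = c * (a * z) := fun z => hac.left_comm z
  have e2 : a * c = c * a := hac.eq
  refine smul_right_injective A hq2 ?_
  simp only [mul_sub, sub_mul, smul_mul_assoc, mul_smul_comm, mul_assoc, smul_sub, mul_add,
    add_mul, e1, e2] at h1 h2 h3 h4 ⊢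
  linear_combination (norm := skip) (q ^ 2) • h1 - h2 + h3 - (q ^ 2) • h4
  match_scalars <;> field_simp <;> ring

variable {q : k} {e : ℕ → A}

namespace IsSerreSeq

lemma commute_rootVec (h : IsSerreSeq q e) (j t : ℕ) :
    ∀ i, j + t + 1 < i → Commute (e i) (rootVec q e j t) := by
  induction t with
  | zero => exact fun i hi => (h.comm _ _ (by omega)).symm
  | succ t ih =>
    exact fun i hi => commute_qcomm q (ih i (by omega)) (h.comm _ _ (by omega)).symm

lemma serre_rootVec (h : IsSerreSeq q e) (j t : ℕ) :
    e (j + t + 1) * e (j + t + 1) * rootVec q e j t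
      + rootVec q e j t * (e (j + t + 1) * e (j + t + 1))
      = (q + q⁻¹) • (e (j + t + 1) * rootVec q e j t * e (j + t + 1)) := by
  cases t with
  | zero => exact h.serre_pred j
  | succ t => exact serre_qcomm (h.commute_rootVec j t _ (by omega)) (h.serre_pred _)

lemma rootVec_mul_last (h : IsSerreSeq q e) (hq : q ≠ 0) (j t : ℕ) :
    rootVec q e j (t + 1) * e (j + t + 1) = q⁻¹ • (e (j + t + 1) * rootVec q e j (t + 1)) :=
  qcomm_of_serre hq (h.serre_rootVec j t)

lemma commute_rootVec_inner (h : IsSerreSeq q e) (hq : q ≠ 0) (hq2 : q + q⁻¹ ≠ 0) (j t s : ℕ) :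
    Commute (e (j + t + 1)) (rootVec q e j (t + 2 + s)) := by
  induction s with
  | zero =>
    exact commute_qcomm_qcomm hq hq2 (h.commute_rootVec j t _ (by omega)).symm
      (h.serre_rootVec j t) (h.serre_succ _)
  | succ s ih => exact commute_qcomm q ih (h.comm _ (j + (t + 2 + s) + 1) (by omega))

lemma rootVec_qcomm (h : IsSerreSeq q e) (hq : q ≠ 0) (hq2 : q + q⁻¹ ≠ 0) (j s t : ℕ) :
    rootVec q e j s * rootVec q e j (s + t + 1)
      = q⁻¹ • (rootVec q e j (s + t + 1) * rootVec q e j s) := by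
  have aux : ∀ (x y z : A), Commute x z → x * y = q⁻¹ • (y * x) →
      x * (y * z - q • (z * y)) = q⁻¹ • ((y * z - q • (z * y)) * x) := by
    intro x y z hz hxy
    have h1 := congrArg (· * z) hxy
    have h2 := congrArg (z * ·) hxy
    have e1 : ∀ w, x * (z * w) = z * (x * w) := fun w => hz.left_comm w
    have e2 : x * z = z * x := hz.eq
    simp only [mul_sub, sub_mul, smul_mul_assoc, mul_smul_comm, mul_assoc, smul_sub, e1, e2]
      at h1 h2 ⊢
    linear_combination (norm := module) h1 - q • h2
  have aux' : ∀ (x y z : A), Commute x z → y * x = q⁻¹ • (x * y) →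
      (y * z - q • (z * y)) * x = q⁻¹ • (x * (y * z - q • (z * y))) := by
    intro x y z hz hxy
    have h1 := congrArg (· * z) hxy
    have h2 := congrArg (z * ·) hxy
    have e1 : ∀ w, x * (z * w) = z * (x * w) := fun w => hz.left_comm w
    have e2 : x * z = z * x := hz.eq
    simp only [mul_sub, sub_mul, smul_mul_assoc, mul_smul_comm, mul_assoc, smul_sub, e1, e2]
      at h1 h2 ⊢
    linear_combination (norm := module) h1 - q • h2
  induction s generalizing t with
  | zero =>
    induction t with
    | zero => exact qcomm_of_serre' hq (h.serre_succ j)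
    | succ t ih => exact aux _ _ _ (h.comm _ _ (by omega)) ih
  | succ s ih =>
    have h1 := ih (t + 1)
    have h2 := (h.commute_rootVec_inner hq hq2 j s t).symm
    rw [show s + (t + 1) + 1 = s + 1 + t + 1 by omega] at h1
    rw [show s + 2 + t = s + 1 + t + 1 by omega] at h2
    exact aux' _ _ _ h2 h1

end IsSerreSeq

end QuantumSerre

section Spanning

open Algebra

variable {k A : Type*} [Field k] [Ring A] [Algebra k A]

lemma list_prod_mul_le (S : Submodule k A) (l : List (Submodule k A))
    (h : ∀ T ∈ l, T * S ≤ S * T) : l.prod * S ≤ S * l.prod := by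
  induction l with
  | nil => simp
  | cons T l ih =>
    rw [List.prod_cons, mul_assoc]
    calc T * (l.prod * S) ≤ T * (S * l.prod) :=
          mul_le_mul_right (ih fun T' hT' => h T' (List.mem_cons_of_mem _ hT')) _
      _ = T * S * l.prod := (mul_assoc _ _ _).symm
      _ ≤ S * T * l.prod := mul_le_mul_left (h T List.mem_cons_self) _
      _ = S * (T * l.prod) := mul_assoc _ _ _

lemma list_prod_closed (l : List (Submodule k A)) (h1 : ∀ S ∈ l, 1 ≤ S)
    (hm : ∀ S ∈ l, S * S ≤ S) (hc : l.Pairwise fun S T => T * S ≤ S * T) :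
    1 ≤ l.prod ∧ l.prod * l.prod ≤ l.prod ∧ ∀ S ∈ l, S ≤ l.prod := by
  induction l with
  | nil => simp
  | cons S l ih =>
    rw [List.pairwise_cons] at hc
    obtain ⟨i1, i2, i3⟩ := ih (fun T hT => h1 T (List.mem_cons_of_mem _ hT))
      (fun T hT => hm T (List.mem_cons_of_mem _ hT)) hc.2
    have hS := h1 S List.mem_cons_self
    have hl : l.prod ≤ S * l.prod := by
      simpa using mul_le_mul_left hS l.prod
    rw [List.prod_cons]
    refine ⟨i1.trans hl, ?_, ?_⟩
    · calc S * l.prod * (S * l.prod) = S * (l.prod * S) * l.prod := by simp only [mul_assoc]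
        _ ≤ S * (S * l.prod) * l.prod :=
          mul_le_mul_left (mul_le_mul_right (list_prod_mul_le S l hc.1) _) _
        _ = (S * S) * (l.prod * l.prod) := by simp only [mul_assoc]
        _ ≤ S * l.prod := mul_le_mul' (hm S List.mem_cons_self) i2
    · intro T hT
      rcases List.mem_cons.1 hT with rfl | hT
      · simpa using mul_le_mul_right i1 T
      · exact (i3 T hT).trans hl

lemma adjoin_le_of_closed {X : Set A} {P : Submodule k A} (hX : X ⊆ P) (h1 : 1 ≤ P)
    (hm : P * P ≤ P) : Subalgebra.toSubmodule (adjoin k X) ≤ P := by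
  intro x hx
  induction hx using adjoin_induction with
  | mem x hx => exact hX hx
  | algebraMap r => exact h1 (Submodule.algebraMap_mem r)
  | add x y _ _ hx hy => exact P.add_mem hx hy
  | mul x y _ _ hx hy => exact hm (Submodule.mul_mem_mul hx hy)

/-- A submodule stable under left multiplication by the generators is stable under the algebra
they generate. -/
lemma adjoin_mul_mem {X : Set A} {N : Submodule k A} (hN : ∀ a ∈ X, ∀ x ∈ N, a * x ∈ N)
    {u x : A} (hu : u ∈ adjoin k X) (hx : x ∈ N) : u * x ∈ N := by
  induction hu using adjoin_induction generalizing x with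
  | mem a ha => exact hN a ha x hx
  | algebraMap r => rw [← Algebra.smul_def]; exact N.smul_mem r hx
  | add a b _ _ ha hb => rw [add_mul]; exact N.add_mem (ha hx) (hb hx)
  | mul a b _ _ ha hb => rw [mul_assoc]; exact ha (hb hx)

/-- A submodule stable under right multiplication by the generators is stable under the algebra
they generate. -/
lemma mul_adjoin_mem {X : Set A} {N : Submodule k A} (hN : ∀ a ∈ X, ∀ x ∈ N, x * a ∈ N)
    {u x : A} (hu : u ∈ adjoin k X) (hx : x ∈ N) : x * u ∈ N := by
  induction hu using adjoin_induction generalizing x with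
  | mem a ha => exact hN a ha x hx
  | algebraMap r => rw [← Algebra.commutes, ← Algebra.smul_def]; exact N.smul_mem r hx
  | add a b _ _ ha hb => rw [mul_add]; exact N.add_mem (ha hx) (hb hx)
  | mul a b _ _ ha hb => rw [← mul_assoc]; exact hb (ha hx)

/-- The span of the powers of an element. -/
def powSpan (k : Type*) {A : Type*} [Field k] [Ring A] [Algebra k A] (y : A) : Submodule k A :=
  Submodule.span k (Set.range fun n : ℕ => y ^ n)

/-- The span of the integral powers of a unit. -/
def zpowSpan (k : Type*) {A : Type*} [Field k] [Ring A] [Algebra k A] (u : Aˣ) : Submodule k A :=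
  Submodule.span k (Set.range fun z : ℤ => ((u ^ z : Aˣ) : A))

lemma one_le_powSpan (y : A) : 1 ≤ powSpan k y :=
  Submodule.one_le.2 (Submodule.subset_span ⟨0, pow_zero y⟩)

lemma mem_powSpan (y : A) : y ∈ powSpan k y :=
  Submodule.subset_span ⟨1, pow_one y⟩

lemma powSpan_mul_self (y : A) : powSpan k y * powSpan k y ≤ powSpan k y := by
  rw [powSpan, Submodule.span_mul_span, Submodule.span_le]
  rintro _ ⟨_, ⟨a, rfl⟩, _, ⟨b, rfl⟩, rfl⟩
  exact Submodule.subset_span ⟨a + b, pow_add y a b⟩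

lemma pow_qcomm {x y : A} {c : k} (h : y * x = c • (x * y)) (a b : ℕ) :
    ∃ d : k, y ^ a * x ^ b = d • (x ^ b * y ^ a) := by
  have h1 : ∀ b : ℕ, ∃ d : k, y * x ^ b = d • (x ^ b * y) := by
    intro b
    induction b with
    | zero => exact ⟨1, by simp⟩
    | succ b ih =>
      obtain ⟨d, hd⟩ := ih
      exact ⟨d * c, by rw [pow_succ, ← mul_assoc, hd, smul_mul_assoc, mul_assoc, h,
        mul_smul_comm, smul_smul, mul_assoc]⟩
  induction a with
  | zero => exact ⟨1, by simp⟩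
  | succ a ih =>
    obtain ⟨d, hd⟩ := ih
    obtain ⟨d', hd'⟩ := h1 b
    exact ⟨d' * d, by rw [pow_succ, mul_assoc, hd', mul_smul_comm, ← mul_assoc, hd,
      smul_mul_assoc, smul_smul, mul_assoc]⟩

lemma powSpan_qcomm {x y : A} {c : k} (h : y * x = c • (x * y)) :
    powSpan k y * powSpan k x ≤ powSpan k x * powSpan k y := by
  simp only [powSpan]
  rw [Submodule.span_mul_span, Submodule.span_le]
  rintro _ ⟨_, ⟨a, rfl⟩, _, ⟨b, rfl⟩, rfl⟩
  obtain ⟨d, hd⟩ := pow_qcomm h a b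
  change y ^ a * x ^ b ∈ _
  rw [hd]
  exact Submodule.smul_mem _ _ (Submodule.mul_mem_mul (Submodule.subset_span ⟨b, rfl⟩)
    (Submodule.subset_span ⟨a, rfl⟩))

lemma one_le_zpowSpan (u : Aˣ) : 1 ≤ zpowSpan k u :=
  Submodule.one_le.2 (Submodule.subset_span ⟨0, by simp⟩)

lemma mem_zpowSpan (u : Aˣ) : (u : A) ∈ zpowSpan k u :=
  Submodule.subset_span ⟨1, by simp⟩

lemma inv_mem_zpowSpan (u : Aˣ) : ((u⁻¹ : Aˣ) : A) ∈ zpowSpan k u :=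
  Submodule.subset_span ⟨-1, by simp⟩

lemma zpowSpan_mul_self (u : Aˣ) : zpowSpan k u * zpowSpan k u ≤ zpowSpan k u := by
  rw [zpowSpan, Submodule.span_mul_span, Submodule.span_le]
  rintro _ ⟨_, ⟨a, rfl⟩, _, ⟨b, rfl⟩, rfl⟩
  exact Submodule.subset_span ⟨a + b, by simp [zpow_add]⟩

lemma zpowSpan_comm {u v : Aˣ} (h : Commute u v) :
    zpowSpan k v * zpowSpan k u ≤ zpowSpan k u * zpowSpan k v := by
  simp only [zpowSpan]
  rw [Submodule.span_mul_span, Submodule.span_le]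
  rintro _ ⟨_, ⟨a, rfl⟩, _, ⟨b, rfl⟩, rfl⟩
  have hd : v ^ a * u ^ b = u ^ b * v ^ a := (h.symm.zpow_zpow a b).eq
  change ((v ^ a : Aˣ) : A) * ((u ^ b : Aˣ) : A) ∈ _
  rw [← Units.val_mul, hd, Units.val_mul]
  exact Submodule.mul_mem_mul (Submodule.subset_span ⟨b, rfl⟩) (Submodule.subset_span ⟨a, rfl⟩)

variable {q : k} {e : ℕ → A}

namespace IsSerreSeq

lemma rootVec_mul_gen (h : IsSerreSeq q e) (hq : q ≠ 0) (hq2 : q + q⁻¹ ≠ 0) (j t i : ℕ)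
    (hi : j < i) : ∃ c d : k, rootVec q e j t * e i
      = c • (e i * rootVec q e j t) + d • rootVec q e j (t + 1) := by
  rcases lt_trichotomy i (j + t) with hlt | rfl | hgt
  · obtain ⟨a, rfl⟩ := Nat.exists_eq_add_of_lt hi
    obtain ⟨s, rfl⟩ : ∃ s, t = a + 2 + s := ⟨t - (a + 2), by omega⟩
    exact ⟨1, 0, by rw [(h.commute_rootVec_inner hq hq2 j a s).eq]; simp⟩
  · obtain ⟨s, rfl⟩ : ∃ s, t = s + 1 := ⟨t - 1, by omega⟩
    exact ⟨q⁻¹, 0, by rw [← add_assoc, h.rootVec_mul_last hq]; simp⟩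
  · rcases eq_or_lt_of_le (Nat.succ_le_of_lt hgt) with rfl | hgt'
    · exact ⟨q, 1, by simp [rootVec]⟩
    · exact ⟨1, 0, by rw [(h.commute_rootVec j t i hgt').eq]; simp⟩

lemma adjoin_le_mul (h : IsSerreSeq q e) (hq : q ≠ 0) (hq2 : q + q⁻¹ ≠ 0) (j : ℕ) :
    Subalgebra.toSubmodule (adjoin k (e '' Set.Ici j))
      ≤ Subalgebra.toSubmodule (adjoin k (e '' Set.Ici (j + 1)))
        * Subalgebra.toSubmodule (adjoin k (Set.range (rootVec q e j))) := by
  set U := Subalgebra.toSubmodule (adjoin k (e '' Set.Ici (j + 1))) with hU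
  set B := Subalgebra.toSubmodule (adjoin k (Set.range (rootVec q e j))) with hB
  have hBB : B * B ≤ B := by rw [hB]; exact (Subalgebra.mul_toSubmodule_le _ _).trans (by simp)
  have hUU : U * U ≤ U := by rw [hU]; exact (Subalgebra.mul_toSubmodule_le _ _).trans (by simp)
  have hB1 : (1 : A) ∈ B := one_mem (adjoin k (Set.range (rootVec q e j)))
  have hU1 : (1 : A) ∈ U := one_mem (adjoin k (e '' Set.Ici (j + 1)))
  have hy : ∀ t, rootVec q e j t ∈ B := fun t => subset_adjoin ⟨t, rfl⟩
  have hBe : ∀ i, j < i → ∀ b ∈ B,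
      b * e i ∈ Submodule.span k {e i} * B ⊔ B := by
    intro i hi b hb
    refine adjoin_mul_mem (X := Set.range (rootVec q e j)) ?_ hb ?_
    · rintro _ ⟨t, rfl⟩ x hx
      obtain ⟨x1, hx1, x2, hx2, rfl⟩ := Submodule.mem_sup.1 hx
      obtain ⟨b', hb', rfl⟩ := Submodule.mem_span_singleton_mul.1 hx1
      obtain ⟨c, d, hcd⟩ := h.rootVec_mul_gen hq hq2 j t i hi
      rw [mul_add, ← mul_assoc, hcd, add_mul, smul_mul_assoc, smul_mul_assoc, mul_assoc]
      refine Submodule.add_mem _ (Submodule.add_mem _ ?_ ?_) ?_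
      · exact Submodule.mem_sup_left (Submodule.smul_mem _ _ (Submodule.mul_mem_mul
          (Submodule.mem_span_singleton_self _) (hBB (Submodule.mul_mem_mul (hy t) hb'))))
      · exact Submodule.mem_sup_right (Submodule.smul_mem _ _
          (hBB (Submodule.mul_mem_mul (hy (t + 1)) hb')))
      · exact Submodule.mem_sup_right (hBB (Submodule.mul_mem_mul (hy t) hx2))
    · refine Submodule.mem_sup_left ?_
      simpa using Submodule.mul_mem_mul (Submodule.mem_span_singleton_self (e i)) hB1
  intro x hx
  have key := mul_adjoin_mem (N := U * B) (X := e '' Set.Ici j) (u := x) (x := 1) ?_ hx ?_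
  · simpa using key
  · rintro _ ⟨i, hi, rfl⟩ z hz
    induction hz using Submodule.mul_induction_on' with
    | mem_mul_mem u hu b hb =>
      rw [mul_assoc]
      rcases eq_or_lt_of_le (Set.mem_Ici.1 hi) with rfl | hi
      · exact Submodule.mul_mem_mul hu (hBB (Submodule.mul_mem_mul hb (hy 0)))
      · obtain ⟨x1, hx1, x2, hx2, hx⟩ := Submodule.mem_sup.1 (hBe i hi b hb)
        obtain ⟨b', hb', rfl⟩ := Submodule.mem_span_singleton_mul.1 hx1
        rw [← hx, mul_add, ← mul_assoc]
        have hei : e i ∈ U := subset_adjoin ⟨i, hi, rfl⟩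
        exact Submodule.add_mem _
          (Submodule.mul_mem_mul (hUU (Submodule.mul_mem_mul hu hei)) hb')
          (Submodule.mul_mem_mul hu hx2)
    | add a _ b _ ha hb => rw [add_mul]; exact Submodule.add_mem _ ha hb
  · simpa using Submodule.mul_mem_mul hU1 hB1

lemma rootVec_eq_zero {n : ℕ} (hn : ∀ i, n ≤ i → e i = 0) (j t : ℕ) (hjt : n ≤ j + t) :
    rootVec q e j t = 0 := by
  cases t with
  | zero => exact hn _ hjt
  | succ t => simp [rootVec, hn (j + t + 1) hjt]

lemma adjoin_rootVec_le (h : IsSerreSeq q e) (hq : q ≠ 0) (hq2 : q + q⁻¹ ≠ 0) {n : ℕ}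
    (hn : ∀ i, n ≤ i → e i = 0) (j m : ℕ) (hm : n ≤ j + m) :
    Subalgebra.toSubmodule (adjoin k (Set.range (rootVec q e j)))
      ≤ ((List.range m).reverse.map fun t => powSpan k (rootVec q e j t)).prod := by
  have hpw : ((List.range m).reverse.map fun t => powSpan k (rootVec q e j t)).Pairwise
      fun S T => T * S ≤ S * T := by
    rw [List.pairwise_map, List.pairwise_reverse]
    refine List.pairwise_lt_range.imp ?_
    intro s t hst
    obtain ⟨a, rfl⟩ := Nat.exists_eq_add_of_lt hst
    exact powSpan_qcomm (h.rootVec_qcomm hq hq2 j s a)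
  obtain ⟨h1, h2, h3⟩ := list_prod_closed _
    (by
      simp only [List.mem_map]
      rintro _ ⟨t, -, rfl⟩
      exact one_le_powSpan _)
    (by
      simp only [List.mem_map]
      rintro _ ⟨t, -, rfl⟩
      exact powSpan_mul_self _) hpw
  refine adjoin_le_of_closed ?_ h1 h2
  rintro _ ⟨t, rfl⟩
  by_cases ht : t < m
  · exact h3 (powSpan k (rootVec q e j t)) (List.mem_map.2 ⟨t, by simpa using ht, rfl⟩)
      (mem_powSpan _)
  · rw [rootVec_eq_zero hn j t (by omega)]
    exact Submodule.zero_mem _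

end IsSerreSeq

/-- The list of the intervals `[j, j + t]` with `n - d ≤ j` and `j + t < n`, in a convex order. -/
def rootIdx (n : ℕ) : ℕ → List (ℕ × ℕ)
  | 0 => []
  | d + 1 => rootIdx n d ++ (List.range (d + 1)).reverse.map fun t => (n - (d + 1), t)

lemma IsSerreSeq.adjoin_le_prod (h : IsSerreSeq q e) (hq : q ≠ 0) (hq2 : q + q⁻¹ ≠ 0) {n : ℕ}
    (hn : ∀ i, n ≤ i → e i = 0) (d : ℕ) (hd : d ≤ n) :
    Subalgebra.toSubmodule (adjoin k (e '' Set.Ici (n - d)))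
      ≤ ((rootIdx n d).map fun p => powSpan k (rootVec q e p.1 p.2)).prod := by
  induction d with
  | zero =>
    refine adjoin_le_of_closed ?_ (by simp [rootIdx]) (by simp [rootIdx])
    rintro _ ⟨i, hi, rfl⟩
    rw [hn i (by simpa using hi)]
    exact Submodule.zero_mem _
  | succ d ih =>
    refine (h.adjoin_le_mul hq hq2 _).trans ?_
    rw [rootIdx, List.map_append, List.prod_append]
    refine mul_le_mul' ?_ ?_
    · rw [show n - (d + 1) + 1 = n - d by omega]
      exact ih (by omega)
    · rw [List.map_map]
      exact h.adjoin_rootVec_le hq hq2 hn _ _ (by omega)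

end Spanning

section TorusRep

variable {k Λ R : Type*} [Field k] [AddCommGroup Λ] [Ring R] [Algebra k R]

/-- The elements `X a` are the monomials of a quantum torus with structure form `B`, and `ev`
reads off coefficients. -/
structure IsTorusRep (q : k) (B : Λ →+ Λ →+ ℤ) (X : Λ → R) (ev : R →ₗ[k] Λ →₀ k) : Prop where
  zero : X 0 = 1
  mul : ∀ a b, X a * X b = q ^ B a b • X (a + b)
  ev_apply : ∀ a, ev (X a) = Finsupp.single a 1

variable {q : k} {B : Λ →+ Λ →+ ℤ} {X : Λ → R} {ev : R →ₗ[k] Λ →₀ k}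

lemma IsTorusRep.qcomm (hX : IsTorusRep q B X ev) (hq : q ≠ 0) {a b : Λ} {m : ℤ}
    (h : B a b - B b a = m) : X a * X b = q ^ m • (X b * X a) := by
  rw [hX.mul, hX.mul, smul_smul, ← zpow_add₀ hq, add_comm b a, ← h, sub_add_cancel]

end TorusRep

section LeadingTerms

variable {k Λ R : Type*} [Field k] [Ring R] [Algebra k R] [PartialOrder Λ] {X : Λ → R}

/-- The span of the monomials with exponent strictly below `v`. -/
def torusLower (k : Type*) [Field k] [Algebra k R] (X : Λ → R) (v : Λ) : Submodule k R :=
  Submodule.span k (X '' Set.Iio v)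

/-- `y` is `c` times the monomial of exponent `v` plus a combination of smaller monomials. -/
def HasLeadTerm (X : Λ → R) (y : R) (c : k) (v : Λ) : Prop :=
  y - c • X v ∈ torusLower k X v

/-- `y` has the leading exponent `v`. -/
def HasLeadExp (k : Type*) [Field k] [Algebra k R] (X : Λ → R) (y : R) (v : Λ) : Prop :=
  ∃ c : k, c ≠ 0 ∧ HasLeadTerm X y c v

lemma hasLeadTerm_smul (c : k) (v : Λ) : HasLeadTerm X (c • X v) c v := by
  rw [HasLeadTerm, sub_self]
  exact Submodule.zero_mem _

lemma hasLeadExp_smul {c : k} (hc : c ≠ 0) (v : Λ) :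
    HasLeadExp k X (c • X v) v :=
  ⟨c, hc, hasLeadTerm_smul c v⟩

lemma HasLeadTerm.sub {y z : R} {c d : k} {v : Λ}
    (hy : HasLeadTerm X y c v) (hz : HasLeadTerm X z d v) :
    HasLeadTerm X (y - z) (c - d) v := by
  have := (torusLower k X v).sub_mem hy hz
  rw [HasLeadTerm]
  convert this using 1
  module

lemma HasLeadTerm.smul {y : R} {c : k} {v : Λ} (d : k)
    (hy : HasLeadTerm X y c v) : HasLeadTerm X (d • y) (d * c) v := by
  have := (torusLower k X v).smul_mem d hy
  rw [HasLeadTerm]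
  convert this using 1
  module

variable [AddCommGroup Λ]

variable {q : k} {B : Λ →+ Λ →+ ℤ} {ev : R →ₗ[k] Λ →₀ k}

lemma hasLeadExp_one (hX : IsTorusRep q B X ev) : HasLeadExp k X 1 0 :=
  ⟨1, one_ne_zero, by
    rw [← hX.zero, HasLeadTerm, one_smul, sub_self]
    exact Submodule.zero_mem _⟩

lemma HasLeadTerm.apply_eq (hX : IsTorusRep q B X ev) {y : R} {c : k} {v w : Λ}
    (hy : HasLeadTerm X y c v) (hw : ¬ w < v) :
    ev y w = Finsupp.single v c w := by
  have hlow : ∀ z ∈ torusLower k X v, ev z w = 0 := by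
    intro z hz
    induction hz using Submodule.span_induction with
    | mem z hz =>
      obtain ⟨b, hb, rfl⟩ := hz
      have hbw : b ≠ w := by rintro rfl; exact hw hb
      simp [hX.ev_apply, hbw]
    | zero => simp
    | add a b _ _ ha hb => simp [ha, hb]
    | smul r a _ ha => simp [ha]
  have h := hlow _ hy
  rw [map_sub, Finsupp.sub_apply, sub_eq_zero] at h
  rw [h]
  simp [hX.ev_apply]

lemma HasLeadExp.apply_self_ne_zero (hX : IsTorusRep q B X ev) {y : R} {v : Λ}
    (hy : HasLeadExp k X y v) : ev y v ≠ 0 := by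
  obtain ⟨c, hc, hy⟩ := hy
  rwa [hy.apply_eq hX (lt_irrefl v), Finsupp.single_eq_same]

lemma HasLeadExp.apply_eq_zero (hX : IsTorusRep q B X ev) {y : R} {v w : Λ}
    (hy : HasLeadExp k X y v) (hw : ¬ w ≤ v) : ev y w = 0 := by
  obtain ⟨c, hc, hy⟩ := hy
  rw [hy.apply_eq hX fun h => hw h.le, Finsupp.single_eq_of_ne]
  rintro rfl
  exact hw le_rfl

variable [IsOrderedCancelAddMonoid Λ]

lemma HasLeadTerm.mul (hX : IsTorusRep q B X ev) {y z : R} {c d : k} {v w : Λ}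
    (hy : HasLeadTerm X y c v) (hz : HasLeadTerm X z d w) :
    HasLeadTerm X (y * z) (c * d * q ^ B v w) (v + w) := by
  have h1 : (y - c • X v) * (z - d • X w) ∈ torusLower k X (v + w) := by
    have := Submodule.mul_mem_mul hy hz
    rw [torusLower, torusLower, Submodule.span_mul_span] at this
    refine Submodule.span_le.2 ?_ this
    rintro _ ⟨_, ⟨a, ha, rfl⟩, _, ⟨b, hb, rfl⟩, rfl⟩
    change X a * X b ∈ torusLower k X (v + w)
    rw [hX.mul]
    exact Submodule.smul_mem _ _ (Submodule.subset_span ⟨_, add_lt_add ha hb, rfl⟩)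
  have h2 : (c • X v) * (z - d • X w) ∈ torusLower k X (v + w) := by
    have := Submodule.mul_mem_mul
      (Submodule.mem_span_singleton_self (R := k) (X v)) hz
    rw [torusLower, Submodule.span_mul_span] at this
    rw [smul_mul_assoc]
    refine Submodule.smul_mem _ _ (Submodule.span_le.2 ?_ this)
    rintro _ ⟨_, rfl, _, ⟨b, hb, rfl⟩, rfl⟩
    change X _ * X b ∈ torusLower k X (v + w)
    rw [hX.mul]
    exact Submodule.smul_mem _ _ (Submodule.subset_span ⟨_, add_lt_add_right hb v, rfl⟩)
  have h3 : (y - c • X v) * (d • X w) ∈ torusLower k X (v + w) := by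
    have := Submodule.mul_mem_mul hy
      (Submodule.mem_span_singleton_self (R := k) (X w))
    rw [torusLower, Submodule.span_mul_span] at this
    rw [mul_smul_comm]
    refine Submodule.smul_mem _ _ (Submodule.span_le.2 ?_ this)
    rintro _ ⟨_, ⟨b, hb, rfl⟩, _, rfl, rfl⟩
    change X b * X _ ∈ torusLower k X (v + w)
    rw [hX.mul]
    exact Submodule.smul_mem _ _ (Submodule.subset_span ⟨_, add_lt_add_left hb w, rfl⟩)
  have h := Submodule.add_mem _ (Submodule.add_mem _ h1 h2) h3
  rw [HasLeadTerm]
  convert h using 1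
  have e : (c * d * q ^ B v w) • X (v + w)
      = (c • X v) * (d • X w) := by
    rw [smul_mul_smul_comm, hX.mul, smul_smul]
  rw [e]
  noncomm_ring

lemma HasLeadExp.mul (hX : IsTorusRep q B X ev) (hq : q ≠ 0) {y z : R} {v w : Λ}
    (hy : HasLeadExp k X y v) (hz : HasLeadExp k X z w) : HasLeadExp k X (y * z) (v + w) := by
  obtain ⟨c, hc, hy⟩ := hy
  obtain ⟨d, hd, hz⟩ := hz
  exact ⟨_, mul_ne_zero (mul_ne_zero hc hd) (zpow_ne_zero _ hq), hy.mul hX hz⟩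

lemma HasLeadExp.pow (hX : IsTorusRep q B X ev) (hq : q ≠ 0) {y : R} {v : Λ}
    (hy : HasLeadExp k X y v) (m : ℕ) : HasLeadExp k X (y ^ m) (m • v) := by
  induction m with
  | zero => simpa using hasLeadExp_one hX
  | succ m ih => rw [pow_succ, succ_nsmul]; exact ih.mul hX hq hy

lemma HasLeadExp.qcomm (hX : IsTorusRep q B X ev) (hq : q ≠ 0) (hq2 : q * q ≠ 1) {y z : R} {v w : Λ}
    (hy : HasLeadExp k X y v) (hz : HasLeadExp k X z w) (h : B v w - B w v = -1) :
    HasLeadExp k X (y * z - q • (z * y)) (v + w) := by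
  obtain ⟨c, hc, hy⟩ := hy
  obtain ⟨d, hd, hz⟩ := hz
  have h2 := (hz.mul hX hy).smul q
  rw [add_comm w v] at h2
  refine ⟨_, ?_, (hy.mul hX hz).sub h2⟩
  rw [show B v w = -1 + B w v by omega, zpow_add₀ hq, zpow_neg_one]
  have : c * d * (q⁻¹ * q ^ B w v) - q * (d * c * q ^ B w v)
      = c * d * q ^ B w v * q⁻¹ * (1 - q * q) := by
    field_simp
  rw [this]
  have := sub_ne_zero.2 hq2.symm
  have := zpow_ne_zero (B w v) hq
  have := inv_ne_zero hq
  positivity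

/-- Leading exponents of the quantum root vectors, when the Chevalley generators are sums of
monomials with interlacing `q`-commutation relations. -/
lemma hasLeadExp_rootVec (hX : IsTorusRep q B X ev) (hq : q ≠ 0) (hq2 : q * q ≠ 1)
    {n : ℕ} {W : ℕ → ℤ → Λ}
    {c : ℕ → ℤ → k} {e : ℕ → R}
    (hc : ∀ t r, c t r ≠ 0)
    (he : ∀ t < n, e t = ∑ r ∈ Finset.Icc (-((t : ℤ) + 1)) t, c t r • X (W t r))
    (hmono : ∀ t < n, ∀ r s : ℤ, -((t : ℤ) + 1) ≤ r → r < s → s ≤ t → W t r < W t s)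
    (hfar : ∀ t u : ℕ, t + 2 ≤ u → u < n → ∀ r s : ℤ, -((t : ℤ) + 1) ≤ r → r ≤ t →
      -((u : ℤ) + 1) ≤ s → s ≤ u → B (W t r) (W u s) - B (W u s) (W t r) = 0)
    (hpos : ∀ t, t + 1 < n → ∀ r s : ℤ, -((t : ℤ) + 1) ≤ r → r ≤ t → r < s → 0 ≤ s → s ≤ t + 1 →
      B (W t r) (W (t + 1) s) - B (W (t + 1) s) (W t r) = 1)
    (hneg : ∀ t, t + 1 < n → ∀ s : ℤ, 0 ≤ s → s ≤ t →
      B (W t s) (W (t + 1) s) - B (W (t + 1) s) (W t s) = -1)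
    (j t : ℕ) (hjt : j + t < n) :
    HasLeadExp k X (rootVec q e j t) (∑ i ∈ Finset.range (t + 1), W (j + i) j) := by
  have hT : ∀ u, j ≤ u → u < n → HasLeadExp k X
      (∑ r ∈ Finset.Icc (-((u : ℤ) + 1)) j, c u r • X (W u r)) (W u j) := by
    intro u hju hu
    refine ⟨c u j, hc _ _, ?_⟩
    rw [HasLeadTerm, ← Finset.sum_erase_eq_sub
      (f := fun r => c u r • X (W u r)) (Finset.mem_Icc.2 ⟨by omega, le_rfl⟩)]
    refine Submodule.sum_mem _ fun r hr =>
      Submodule.smul_mem _ _ (Submodule.subset_span ⟨_, ?_, rfl⟩)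
    simp only [Finset.mem_erase, Finset.mem_Icc] at hr
    exact hmono u hu r j hr.2.1 (by omega) (by omega)
  have hefar : ∀ u, u < n → ∀ v, u + 2 ≤ v → v < n → ∀ s : ℤ, -((v : ℤ) + 1) ≤ s → s ≤ v →
      Commute (e u) (X (W v s)) := by
    intro u hu v huv hv s hs1 hs2
    rw [he u hu]
    refine Commute.sum_left _ _ _ fun r hr => Commute.smul_left ?_ _
    rw [Finset.mem_Icc] at hr
    exact (hX.qcomm hq (hfar u v huv hv r s hr.1 hr.2 hs1 hs2)).trans (by rw [zpow_zero, one_smul])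
  have main : ∀ t, j + t < n →
      HasLeadExp k X (rootVec q e j t) (∑ i ∈ Finset.range (t + 1), W (j + i) j) ∧
      (j + t + 1 < n → ∀ s : ℤ, (j : ℤ) + 1 ≤ s → s ≤ j + t + 1 →
        rootVec q e j t * X (W (j + t + 1) s)
          = q • (X (W (j + t + 1) s) * rootVec q e j t)) ∧
      ∀ u, j + t + 2 ≤ u → u < n → ∀ s : ℤ, -((u : ℤ) + 1) ≤ s → s ≤ u →
        Commute (rootVec q e j t) (X (W u s)) := by
    intro t
    induction t with
    | zero =>
      intro hj
      refine ⟨?_, ?_, ?_⟩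
      · have := hT j le_rfl hj
        rw [← he j hj] at this
        simpa [rootVec] using this
      · intro hj' s hs1 hs2
        simp only [rootVec, add_zero] at hs2 ⊢
        rw [he j hj, Finset.sum_mul, Finset.mul_sum, Finset.smul_sum]
        refine Finset.sum_congr rfl fun r hr => ?_
        rw [Finset.mem_Icc] at hr
        rw [smul_mul_assoc, mul_smul_comm,
          hX.qcomm hq (hpos j hj' r s hr.1 hr.2 (by omega) (by omega) (by push_cast at hs2; omega)),
          zpow_one, smul_comm]
      · intro u hu hu' s hs1 hs2
        exact hefar j hj u hu hu' s hs1 hs2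
    | succ t ih =>
      intro hj
      obtain ⟨ih1, ih2, ih3⟩ := ih (by omega)
      set Y := rootVec q e j t with hY
      set u := j + t + 1 with hu
      set T := ∑ r ∈ Finset.Icc (-((u : ℤ) + 1)) j, c u r • X (W u r) with hTdef
      set S := ∑ r ∈ Finset.Icc ((j : ℤ) + 1) u, c u r • X (W u r) with hSdef
      have heu : e u = T + S := by
        rw [he u hj, hTdef, hSdef, ← Finset.sum_union]
        · congr 1
          ext r
          simp only [Finset.mem_Icc, Finset.mem_union]
          omega
        · rw [Finset.disjoint_left]
          intro r
          simp only [Finset.mem_Icc]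
          omega
      have hYS : Y * S = q • (S * Y) := by
        rw [hSdef, Finset.sum_mul, Finset.mul_sum, Finset.smul_sum]
        refine Finset.sum_congr rfl fun r hr => ?_
        rw [Finset.mem_Icc] at hr
        rw [mul_smul_comm, smul_mul_assoc, ih2 hj r hr.1 (by omega), smul_comm]
      have hYT : rootVec q e j (t + 1) = Y * T - q • (T * Y) := by
        rw [rootVec, ← hY, ← hu, heu, mul_add, add_mul, hYS, smul_add]
        abel
      refine ⟨?_, ?_, ?_⟩
      · rw [hYT, Finset.sum_range_succ]
        refine ih1.qcomm hX hq hq2 (hT u (by omega) hj) ?_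
        change B _ (W u j) - B (W u j) _ = -1
        rw [Finset.sum_range_succ]
        simp only [map_add, map_sum, AddMonoidHom.add_apply, AddMonoidHom.finsetSum_apply]
        have h1 := hneg (j + t) hj j (by omega) (by push_cast; omega)
        have h2 : ∑ i ∈ Finset.range t, B (W (j + i) j) (W u j)
            - ∑ i ∈ Finset.range t, B (W u j) (W (j + i) j) = 0 := by
          rw [← Finset.sum_sub_distrib]
          refine Finset.sum_eq_zero fun i hi => ?_
          rw [Finset.mem_range] at hi
          exact hfar (j + i) u (by omega) hj j j (by omega) (by omega) (by omega) (by omega)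
        rw [← hu] at h1
        linarith
      · intro hu2 s hs1 hs2
        have h1 : Commute Y (X (W (u + 1) s)) :=
          ih3 (u + 1) (by omega) hu2 s (by push_cast; omega) (by push_cast at hs2 ⊢; omega)
        have h2 : T * X (W (u + 1) s) = q • (X (W (u + 1) s) * T) := by
          rw [hTdef, Finset.sum_mul, Finset.mul_sum, Finset.smul_sum]
          refine Finset.sum_congr rfl fun r hr => ?_
          rw [Finset.mem_Icc] at hr
          rw [smul_mul_assoc, mul_smul_comm, hX.qcomm hq (hpos u hu2 r s hr.1 (by omega)
            (by omega) (by omega) (by push_cast at hs2 ⊢; omega)), zpow_one, smul_comm]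
        rw [hYT]
        change (Y * T - q • (T * Y)) * X (W (u + 1) s)
          = q • (X (W (u + 1) s) * (Y * T - q • (T * Y)))
        simp only [sub_mul, mul_sub, smul_mul_assoc, mul_smul_comm, mul_assoc, h2, h1.eq]
        rw [← mul_assoc Y, h1.eq, ← mul_assoc T, h2]
        simp only [smul_mul_assoc, mul_assoc, smul_sub]
      · intro v hv hv' s hs1 hs2
        have h1 := ih3 v (by omega) hv' s hs1 hs2
        have h2 := hefar u hj v (by omega) hv' s hs1 hs2
        exact (commute_qcomm q h1.symm h2.symm).symm
  exact (main t hjt).1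

end LeadingTerms

lemma zsmul_right_injective_of_map_ne_zero {Λ : Type*} [AddCommGroup Λ] {v : Λ}
    (l : Λ →+ ℤ) (hl : l v ≠ 0) :
    Function.Injective fun z : ℤ => z • v := by
  intro a b h
  have := congrArg l h
  simpa [hl] using this

section TorusOp

variable {k Λ : Type*} [Field k] [AddCommGroup Λ]

/-- The operator on `k[Λ]` by which the monomial of exponent `a` of the quantum torus with
structure form `B` acts. -/
def torusOp (q : k) (B : Λ →+ Λ →+ ℤ) (a : Λ) : Module.End k (Λ →₀ k) :=
  Finsupp.linearCombination k fun b => Finsupp.single (a + b) (q ^ B a b)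

/-- Evaluation of an operator on `k[Λ]` at the unit monomial. -/
def evalUnit (k Λ : Type*) [Field k] [AddCommGroup Λ] :
    Module.End k (Λ →₀ k) →ₗ[k] Λ →₀ k :=
  LinearMap.applyₗ (Finsupp.single 0 1)

variable {q : k} {B : Λ →+ Λ →+ ℤ}

lemma torusOp_single (a b : Λ) (c : k) :
    torusOp q B a (Finsupp.single b c) = Finsupp.single (a + b) (c * q ^ B a b) := by
  simp [torusOp]

lemma isTorusRep_torusOp (hq : q ≠ 0) : IsTorusRep q B (torusOp q B) (evalUnit k Λ) where
  zero := by
    ext b : 2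
    simp [torusOp_single]
  mul a b := by
    refine Finsupp.lhom_ext fun c x => ?_
    simp only [Module.End.mul_apply, torusOp_single, LinearMap.smul_apply, Finsupp.smul_single,
      smul_eq_mul, map_add, AddMonoidHom.add_apply, zpow_add₀ hq, add_assoc]
    congr 1
    ring
  ev_apply a := by simp [evalUnit, torusOp_single]

end TorusOp

section LeadBasis

variable {k Λ A R : Type*} [Field k] [AddCommGroup Λ] [PartialOrder Λ] [Ring A] [Algebra k A]
  [Ring R] [Algebra k R] {q : k} {B : Λ →+ Λ →+ ℤ} {X : Λ → R} {ev : R →ₗ[k] Λ →₀ k}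

/-- `S` is contained in the span of elements whose images under `g` have distinct leading
exponents, all in `H`. -/
def HasLeadBasis (X : Λ → R) (g : A →ₐ[k] R) (S : Submodule k A) (H : AddSubgroup Λ) : Prop :=
  ∃ (ι : Type) (m : ι → A) (φ : ι → Λ), S ≤ Submodule.span k (Set.range m) ∧
    Function.Injective φ ∧ (∀ i, φ i ∈ H) ∧ ∀ i, HasLeadExp k X (g (m i)) (φ i)

variable {g : A →ₐ[k] R}

lemma HasLeadBasis.mono {S T : Submodule k A} {H H' : AddSubgroup Λ} (h : HasLeadBasis X g S H)
    (hS : T ≤ S) (hH : H ≤ H') : HasLeadBasis X g T H' := by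
  obtain ⟨ι, m, φ, h1, h2, h3, h4⟩ := h
  exact ⟨ι, m, φ, hS.trans h1, h2, fun i => hH (h3 i), h4⟩

lemma hasLeadBasis_one (hX : IsTorusRep q B X ev) : HasLeadBasis X g (1 : Submodule k A) ⊥ := by
  refine ⟨Unit, fun _ => 1, fun _ => 0, ?_, Function.injective_of_subsingleton _,
    fun _ => zero_mem _, fun _ => ?_⟩
  · rw [Submodule.one_eq_span, Set.range_const]
  · rw [map_one]
    exact hasLeadExp_one hX

lemma HasLeadBasis.injective (hX : IsTorusRep q B X ev) {H : AddSubgroup Λ}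
    (h : HasLeadBasis X g ⊤ H) : Function.Injective g := by
  obtain ⟨ι, m, φ, h1, h2, -, h4⟩ := h
  rw [injective_iff_map_eq_zero]
  intro x hx
  obtain ⟨c, rfl⟩ := Finsupp.mem_span_range_iff_exists_finsupp.1 (h1 (Submodule.mem_top (x := x)))
  by_contra hne
  have hc : c.support.Nonempty := by
    rw [Finsupp.support_nonempty_iff]
    rintro rfl
    simp at hne
  obtain ⟨i, hi⟩ := c.support.finite_toSet.exists_maximalFor φ _ hc
  have key : ev (g (c.sum fun i a => a • m i)) (φ i) = c i * ev (g (m i)) (φ i) := by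
    rw [Finsupp.sum, map_sum, map_sum, Finsupp.finsetSum_apply, Finset.sum_eq_single i]
    · simp
    · intro j hj hji
      rw [map_smul, map_smul, Finsupp.smul_apply, (h4 j).apply_eq_zero hX, smul_zero]
      intro hle
      exact hji (h2 (le_antisymm (hi.2 hj hle) hle))
    · intro hi'
      exact absurd hi.1 hi'
  rw [hx, map_zero, Finsupp.zero_apply] at key
  exact mul_ne_zero (Finsupp.mem_support_iff.1 hi.1) ((h4 i).apply_self_ne_zero hX) key.symm

variable [IsOrderedCancelAddMonoid Λ]

lemma HasLeadBasis.mul (hX : IsTorusRep q B X ev) (hq : q ≠ 0) {S T : Submodule k A}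
    {H H' : AddSubgroup Λ} (hS : HasLeadBasis X g S H) (hT : HasLeadBasis X g T H')
    (hH : Disjoint H H') : HasLeadBasis X g (S * T) (H ⊔ H') := by
  obtain ⟨ι, m, φ, h1, h2, h3, h4⟩ := hS
  obtain ⟨ι', m', φ', h1', h2', h3', h4'⟩ := hT
  refine ⟨ι × ι', fun i => m i.1 * m' i.2, fun i => φ i.1 + φ' i.2, ?_, ?_, ?_, ?_⟩
  · refine (mul_le_mul' h1 h1').trans ?_
    rw [Submodule.span_mul_span, Submodule.span_le]
    rintro _ ⟨_, ⟨i, rfl⟩, _, ⟨j, rfl⟩, rfl⟩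
    exact Submodule.subset_span ⟨(i, j), rfl⟩
  · rintro ⟨i, j⟩ ⟨i', j'⟩ h
    have h : φ i + φ' j = φ i' + φ' j' := h
    have e : φ i - φ i' = φ' j' - φ' j := by
      rw [sub_eq_sub_iff_add_eq_add, h, add_comm]
    have h0 : φ i - φ i' = 0 := (AddSubgroup.disjoint_def.1 hH)
      (sub_mem (h3 i) (h3 i')) (e ▸ sub_mem (h3' j') (h3' j))
    have e1 := h2 (sub_eq_zero.1 h0)
    have e2 := h2' (sub_eq_zero.1 (e.symm.trans h0))
    rw [e1, e2]
  · exact fun i => add_mem (AddSubgroup.mem_sup_left (h3 _)) (AddSubgroup.mem_sup_right (h3' _))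
  · intro i
    rw [map_mul]
    exact (h4 _).mul hX hq (h4' _)

lemma hasLeadBasis_powSpan (hX : IsTorusRep q B X ev) (hq : q ≠ 0) {y : A} {v : Λ}
    (hy : HasLeadExp k X (g y) v) (l : Λ →+ ℤ) (hl : l v ≠ 0) :
    HasLeadBasis X g (powSpan k y) (AddSubgroup.zmultiples v) := by
  refine ⟨ℕ, fun a => y ^ a, fun a => a • v, le_rfl, ?_, fun a => ?_, fun a => ?_⟩
  · intro a b h
    have := zsmul_right_injective_of_map_ne_zero l hl (a₁ := (a : ℤ)) (a₂ := b) (by simpa using h)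
    exact_mod_cast this
  · exact nsmul_mem (AddSubgroup.mem_zmultiples v) a
  · rw [map_pow]
    exact hy.pow hX hq a

lemma hasLeadBasis_zpowSpan (hX : IsTorusRep q B X ev) (hq : q ≠ 0) {u : Aˣ} {v : Λ} {c : k}
    (hc : c ≠ 0) (hu : g u = c • X v) (l : Λ →+ ℤ) (hl : l v ≠ 0) :
    HasLeadBasis X g (zpowSpan k u) (AddSubgroup.zmultiples v) := by
  have hu1 : HasLeadExp k X (g u) v := hu ▸ hasLeadExp_smul hc v
  have hu2 : HasLeadExp k X (g ((u⁻¹ : Aˣ) : A)) (-v) := by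
    have e : g ((u⁻¹ : Aˣ) : A) = (c * q ^ B v (-v))⁻¹ • X (-v) := by
      have h1 : g ((u⁻¹ : Aˣ) : A) * g u = 1 := by rw [← map_mul, Units.inv_mul, map_one]
      have h2 : g u * ((c * q ^ B v (-v))⁻¹ • X (-v)) = 1 := by
        rw [hu, smul_mul_smul_comm, hX.mul, smul_smul, add_neg_cancel, hX.zero]
        have := zpow_ne_zero (B v (-v)) hq
        rw [show c * (c * q ^ B v (-v))⁻¹ * q ^ B v (-v) = 1 by field_simp, one_smul]
      exact left_inv_eq_right_inv h1 h2
    rw [e]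
    exact hasLeadExp_smul (inv_ne_zero (mul_ne_zero hc (zpow_ne_zero _ hq))) _
  refine ⟨ℤ, fun z => ((u ^ z : Aˣ) : A), fun z => z • v, le_rfl,
    zsmul_right_injective_of_map_ne_zero l hl, fun z => AddSubgroup.zsmul_mem_zmultiples v z, ?_⟩
  intro z
  obtain ⟨m, rfl | rfl⟩ := z.eq_nat_or_neg
  · simpa using hu1.pow hX hq m
  · simpa using hu2.pow hX hq m

lemma hasLeadBasis_list_prod (hX : IsTorusRep q B X ev) (hq : q ≠ 0) {γ : Type*}
    {S : γ → Submodule k A} {v : γ → Λ} {L : γ → Λ →+ ℤ} (l : List γ)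
    (hS : ∀ s ∈ l, HasLeadBasis X g (S s) (AddSubgroup.zmultiples (v s)))
    (hL : ∀ s ∈ l, L s (v s) ≠ 0) (hl : l.Pairwise fun s t => L s (v t) = 0) :
    HasLeadBasis X g (l.map S).prod (AddSubgroup.closure (v '' {s | s ∈ l})) := by
  induction l with
  | nil => exact (hasLeadBasis_one hX).mono le_rfl bot_le
  | cons s l ih =>
    rw [List.pairwise_cons] at hl
    have ih := ih (fun t ht => hS t (List.mem_cons_of_mem _ ht))
      (fun t ht => hL t (List.mem_cons_of_mem _ ht)) hl.2
    rw [List.map_cons, List.prod_cons]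
    refine ((hS s List.mem_cons_self).mul hX hq ih ?_).mono le_rfl ?_
    · rw [AddSubgroup.disjoint_def]
      rintro _ ⟨z, rfl⟩ hx
      have hle : AddSubgroup.closure (v '' {s | s ∈ l}) ≤ (L s).ker := by
        rw [AddSubgroup.closure_le]
        rintro _ ⟨t, ht, rfl⟩
        exact hl.1 t ht
      have h0 : L s (z • v s) = 0 := hle hx
      rw [map_zsmul, smul_eq_mul, mul_eq_zero] at h0
      simp [h0.resolve_right (hL s List.mem_cons_self)]
    · refine sup_le ?_ (AddSubgroup.closure_mono (Set.image_mono fun t ht =>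
        List.mem_cons_of_mem _ ht))
      rw [AddSubgroup.zmultiples_le]
      exact AddSubgroup.subset_closure ⟨s, List.mem_cons_self, rfl⟩

end LeadBasis

section Quiver

lemma list_sum_map_range {M : Type*} [AddCommMonoid M] (f : ℕ → M) (n : ℕ) :
    ((List.range n).map f).sum = ∑ k ∈ Finset.range n, f k := by
  induction n with
  | zero => simp
  | succ n ih => simp [List.range_succ, Finset.sum_range_succ, ih]

lemma list_sum_map_flatMap_range {α M : Type*} [AddCommMonoid M] (f : ℕ → List α) (g : α → M)
    (n : ℕ) : (((List.range n).flatMap f).map g).sum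
      = ∑ k ∈ Finset.range n, ((f k).map g).sum := by
  induction n with
  | zero => simp
  | succ n ih => simp [List.range_succ, Finset.sum_range_succ, ih]

lemma flatMap_singleton_eq_map {α β : Type*} (f : α → β) (l : List α) :
    (l.flatMap fun a => [f a]) = l.map f :=
  List.map_eq_flatMap.symm

/-- Sums over the arrows of the quiver. -/
lemma sum_dnArrows (n : ℕ) (g : DnLabel × DnLabel × ℤ → ℤ) :
    ((dnArrows n).map g).sum =
      (∑ i ∈ Finset.range n, ∑ k ∈ Finset.range (2 * i + 2),
        g (.V ((i : ℤ) + 1) (-((i : ℤ) + 1) + k), .V ((i : ℤ) + 1) (-((i : ℤ) + 1) + k + 1), 2))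
      + (∑ i ∈ Finset.range n, ∑ k ∈ Finset.range (2 * i + 2),
        g (Lam n ((i : ℤ) + 1) (-((i : ℤ) + 1) + k),
          Lam n ((i : ℤ) + 1) (-((i : ℤ) + 1) + k + 1), 2))
      + (∑ i ∈ Finset.range (n - 1),
        g (.V ((i : ℤ) + 1) (-((i : ℤ) + 1)), .V ((i : ℤ) + 2) (-((i : ℤ) + 2)), 1))
      + (∑ i ∈ Finset.range (n - 1),
        g (.V ((i : ℤ) + 2) ((i : ℤ) + 2), .V ((i : ℤ) + 1) ((i : ℤ) + 1), 1))
      + ∑ i ∈ Finset.range (n - 1), ((∑ k ∈ Finset.range (n - 1 - i),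
          g (.V ((i : ℤ) + 1 + k) (-(k : ℤ)), .V ((i : ℤ) + 2 + k) (-(k : ℤ) - 1), 2))
        + (g (.V (n : ℤ) ((i : ℤ) + 1 - n), .C ((i : ℤ) + 1), 2)
          + g (.C ((i : ℤ) + 1), .V (n : ℤ) ((n : ℤ) - (i + 1)), 2))
        + ∑ k ∈ Finset.range (n - 1 - i),
          g (.V ((i : ℤ) + 2 + k) ((k : ℤ) + 1), .V ((i : ℤ) + 1 + k) (k : ℤ), 2)) := by
  simp only [dnArrows, List.map_append, List.sum_append, list_sum_map_flatMap_range,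
    List.bind_eq_flatMap, List.pure_def, flatMap_singleton_eq_map,
    List.map_map, list_sum_map_range, Function.comp_def, List.map_cons, List.map_nil,
    List.sum_cons, List.sum_nil, add_zero]

/-- The involution of the labels induced by the rotation of the quiver. -/
def rotLabel (n : ℕ) : DnLabel → DnLabel
  | .V a c => if a ≤ n then Lam n a c else .V a c
  | .C a => if a ≤ n then .V a 0 else .C a

lemma rotLabel_V {n : ℕ} {a : ℤ} (c : ℤ) (ha : a ≤ n) : rotLabel n (.V a c) = Lam n a c :=
  if_pos ha

lemma rotLabel_C {n : ℕ} {a : ℤ} (ha : a ≤ n) : rotLabel n (.C a) = .V a 0 :=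
  if_pos ha

lemma rotLabel_rotLabel (n : ℕ) (v : DnLabel) : rotLabel n (rotLabel n v) = v := by
  rcases v with ⟨a, c⟩ | a
  · by_cases ha : a ≤ n
    · rw [rotLabel_V _ ha, Lam]
      split_ifs with h1 h2
      · rw [rotLabel_V _ (by unfold th; omega), Lam, if_neg (by unfold th; omega),
          if_pos (by unfold th; omega)]
        simp [th]
      · rw [rotLabel_V _ (by unfold th; omega), Lam, if_pos (by unfold th; omega)]
        simp [th]
      · rw [rotLabel_C ha]
        congr
        omega
    · simp [rotLabel, ha]
  · by_cases ha : a ≤ n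
    · rw [rotLabel_C ha, rotLabel_V _ ha]
      simp [Lam]
    · simp [rotLabel, ha]

lemma rotLabel_Lam {n : ℕ} {a : ℤ} (c : ℤ) (ha : a ≤ n) : rotLabel n (Lam n a c) = .V a c := by
  rw [← rotLabel_V c ha, rotLabel_rotLabel]

lemma rotLabel_V_pos {n : ℕ} {a c : ℤ} (ha : a ≤ n) (hc : 0 < c) :
    rotLabel n (.V a c) = .V (n + 1 - c) (a - n - 1) := by
  rw [rotLabel_V _ ha, Lam, if_pos hc, th, th]
  congr 1
  ring

lemma rotLabel_V_neg {n : ℕ} {a c : ℤ} (ha : a ≤ n) (hc : c < 0) :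
    rotLabel n (.V a c) = .V (n + 1 + c) (n + 1 - a) := by
  rw [rotLabel_V _ ha, Lam, if_neg (by omega), if_pos hc, th, th]
  congr 1
  ring

lemma rotLabel_V_zero {n : ℕ} {a : ℤ} (ha : a ≤ n) : rotLabel n (.V a 0) = .C a := by
  rw [rotLabel_V _ ha, Lam, if_neg (by omega), if_neg (by omega)]

/-- Rotation permutes the arrows of the quiver. -/
lemma sum_dnArrows_rot (n : ℕ) (g : DnLabel × DnLabel × ℤ → ℤ) :
    ((dnArrows n).map fun a => g (rotLabel n a.1, rotLabel n a.2.1, a.2.2)).sum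
      = ((dnArrows n).map g).sum := by
  have aux : ∀ a₁ a₂ a₃ a₄ a₅ b₁ b₂ b₃ b₄ b₅ : ℤ, a₁ = b₂ → a₂ = b₁ → a₃ = b₄ → a₄ = b₃ →
      a₅ = b₅ → a₁ + a₂ + a₃ + a₄ + a₅ = b₁ + b₂ + b₃ + b₄ + b₅ := by
    intros
    omega
  rw [sum_dnArrows, sum_dnArrows]
  refine aux _ _ _ _ _ _ _ _ _ _ ?_ ?_ ?_ ?_ ?_
  · refine Finset.sum_congr rfl fun i hi => Finset.sum_congr rfl fun k hk => ?_
    rw [Finset.mem_range] at hi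
    rw [rotLabel_V _ (by omega), rotLabel_V _ (by omega)]
  · refine Finset.sum_congr rfl fun i hi => Finset.sum_congr rfl fun k hk => ?_
    rw [Finset.mem_range] at hi
    rw [rotLabel_Lam _ (by omega), rotLabel_Lam _ (by omega)]
  · rw [← Finset.sum_range_reflect]
    refine Finset.sum_congr rfl fun i hi => ?_
    rw [Finset.mem_range] at hi
    rw [rotLabel_V_neg (by omega) (by omega), rotLabel_V_neg (by omega) (by omega)]
    congr 1
    simp only [Prod.mk.injEq, DnLabel.V.injEq, and_true]
    omega
  · rw [← Finset.sum_range_reflect]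
    refine Finset.sum_congr rfl fun i hi => ?_
    rw [Finset.mem_range] at hi
    rw [rotLabel_V_pos (by omega) (by omega), rotLabel_V_pos (by omega) (by omega)]
    congr 1
    simp only [Prod.mk.injEq, DnLabel.V.injEq, and_true]
    omega
  · refine Finset.sum_congr rfl fun i hi => ?_
    rw [Finset.mem_range] at hi
    obtain ⟨m, hm⟩ : ∃ m, n - 1 - i = m + 1 := ⟨n - 2 - i, by omega⟩
    have h1 : ∀ k ∈ Finset.range m,
        g (rotLabel n (.V ((i : ℤ) + 1 + (k + 1 : ℕ)) (-((k + 1 : ℕ) : ℤ))),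
          rotLabel n (.V ((i : ℤ) + 2 + (k + 1 : ℕ)) (-((k + 1 : ℕ) : ℤ) - 1)), 2)
        = g (.V ((i : ℤ) + 2 + (m - 1 - k + 1 : ℕ)) (((m - 1 - k + 1 : ℕ) : ℤ) + 1),
          .V ((i : ℤ) + 1 + (m - 1 - k + 1 : ℕ)) ((m - 1 - k + 1 : ℕ) : ℤ), 2) := by
      intro k hk
      rw [Finset.mem_range] at hk
      rw [rotLabel_V_neg (by omega) (by omega), rotLabel_V_neg (by omega) (by omega)]
      congr 1
      simp only [Prod.mk.injEq, DnLabel.V.injEq, and_true]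
      omega
    have h2 : ∀ k ∈ Finset.range m,
        g (rotLabel n (.V ((i : ℤ) + 2 + (k + 1 : ℕ)) (((k + 1 : ℕ) : ℤ) + 1)),
          rotLabel n (.V ((i : ℤ) + 1 + (k + 1 : ℕ)) ((k + 1 : ℕ) : ℤ)), 2)
        = g (.V ((i : ℤ) + 1 + (m - 1 - k + 1 : ℕ)) (-((m - 1 - k + 1 : ℕ) : ℤ)),
          .V ((i : ℤ) + 2 + (m - 1 - k + 1 : ℕ)) (-((m - 1 - k + 1 : ℕ) : ℤ) - 1), 2) := by
      intro k hk
      rw [Finset.mem_range] at hk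
      rw [rotLabel_V_pos (by omega) (by omega), rotLabel_V_pos (by omega) (by omega)]
      congr 1
      simp only [Prod.mk.injEq, DnLabel.V.injEq, and_true]
      omega
    rw [hm, Finset.sum_range_succ', Finset.sum_range_succ', Finset.sum_range_succ',
      Finset.sum_range_succ', Finset.sum_congr rfl h1, Finset.sum_congr rfl h2,
      Finset.sum_range_reflect (fun k => g (.V ((i : ℤ) + 2 + (k + 1 : ℕ)) (((k + 1 : ℕ) : ℤ) + 1),
        .V ((i : ℤ) + 1 + (k + 1 : ℕ)) ((k + 1 : ℕ) : ℤ), 2)),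
      Finset.sum_range_reflect (fun k => g (.V ((i : ℤ) + 1 + (k + 1 : ℕ)) (-((k + 1 : ℕ) : ℤ)),
        .V ((i : ℤ) + 2 + (k + 1 : ℕ)) (-((k + 1 : ℕ) : ℤ) - 1), 2))]
    simp only [Nat.cast_zero, neg_zero, add_zero, zero_add, zero_sub]
    rw [rotLabel_V_zero (by omega), rotLabel_V_neg (by omega) (by omega),
      rotLabel_V_neg (by omega) (by omega), rotLabel_C (by omega),
      rotLabel_V_pos (by omega) (by omega), rotLabel_V_pos (by omega) (by omega)]
    rw [show (n : ℤ) + 1 + -1 = n by ring, show (n : ℤ) + 1 - ((i : ℤ) + 2) = n - (i + 1) by ring,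
      show (n : ℤ) + 1 + ((i : ℤ) + 1 - n) = i + 2 by ring, show (n : ℤ) + 1 - n = 1 by ring,
      show (n : ℤ) + 1 - (n - ((i : ℤ) + 1)) = i + 2 by ring, show (n : ℤ) - n - 1 = -1 by ring,
      show (n : ℤ) + 1 - 1 = n by ring, show (i : ℤ) + 2 - n - 1 = i + 1 - n by ring]
    ring

end Quiver

section RowExponents

lemma sum_range_ite_interval (N : ℕ) (lo hi c : ℤ) :
    ∑ x ∈ Finset.range N, (if lo ≤ (x : ℤ) ∧ (x : ℤ) ≤ hi then c else 0)
      = c * max 0 (min (hi + 1) N - max lo 0) := by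
  induction N with
  | zero =>
    rw [Finset.sum_range_zero, show max 0 (min (hi + 1) ((0 : ℕ) : ℤ) - max lo 0) = 0 by
      push_cast; omega, mul_zero]
  | succ N ih =>
    rw [Finset.sum_range_succ, ih]
    split_ifs with h
    · rw [show max 0 (min (hi + 1) ((N + 1 : ℕ) : ℤ) - max lo 0)
        = max 0 (min (hi + 1) N - max lo 0) + 1 by push_cast; omega]
      ring
    · rw [show max 0 (min (hi + 1) ((N + 1 : ℕ) : ℤ) - max lo 0)
        = max 0 (min (hi + 1) N - max lo 0) by push_cast; omega]
      ring

lemma sum_range_ite_eq (N : ℕ) (x₀ c : ℤ) (p : Prop) [Decidable p] :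
    ∑ x ∈ Finset.range N, (if (x : ℤ) = x₀ ∧ p then c else 0)
      = if 0 ≤ x₀ ∧ x₀ < N ∧ p then c else 0 := by
  by_cases hp : p
  · simp only [hp, and_true]
    induction N with
    | zero => rw [Finset.sum_range_zero, if_neg (by push_cast; omega)]
    | succ N ih =>
      rw [Finset.sum_range_succ, ih]
      push_cast
      split_ifs <;> omega
  · simp [hp]

/-- The bilinear form counting arrows of the quiver. -/
def quiverForm (n : ℕ) : (DnLabel → ℤ) →+ (DnLabel → ℤ) →+ ℤ :=
  AddMonoidHom.mk' (fun a => AddMonoidHom.mk'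
      (fun b => ((dnArrows n).map fun r => r.2.2 * a r.2.1 * b r.1).sum)
      fun b c => by rw [← List.sum_map_add]; simp only [Pi.add_apply, mul_add])
    fun a b => by
      ext c
      simp only [AddMonoidHom.mk'_apply, AddMonoidHom.add_apply, Pi.add_apply, mul_add, add_mul,
        List.sum_map_add]

lemma quiverForm_apply (n : ℕ) (a b : DnLabel → ℤ) :
    quiverForm n a b = ((dnArrows n).map fun r => r.2.2 * a r.2.1 * b r.1).sum := rfl

lemma quiverForm_rot (n : ℕ) (a b : DnLabel → ℤ) :
    quiverForm n (a ∘ rotLabel n) (b ∘ rotLabel n) = quiverForm n a b :=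
  sum_dnArrows_rot n fun r => r.2.2 * a r.2.1 * b r.1

/-- The exponent of the monomial `X_{V_{i,−i}} ⋯ X_{V_{i,r}}`. -/
def rowExp (i r : ℤ) : DnLabel → ℤ
  | .V a c => if a = i ∧ -i ≤ c ∧ c ≤ r then 1 else 0
  | .C _ => 0

lemma rowExp_V (i r a c : ℤ) :
    rowExp i r (.V a c) = if a = i ∧ -i ≤ c ∧ c ≤ r then 1 else 0 := rfl

lemma rowExp_C (i r a : ℤ) : rowExp i r (.C a) = 0 := rfl

lemma rowExp_Lam (n : ℕ) (i r a c : ℤ) : rowExp i r (Lam n a c) =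
    if (0 < c ∧ n + 1 - c = i ∧ -i ≤ a - n - 1 ∧ a - n - 1 ≤ r) ∨
      (c < 0 ∧ n + 1 + c = i ∧ -i ≤ n + 1 - a ∧ n + 1 - a ≤ r) then 1 else 0 := by
  rw [Lam]
  split_ifs <;> simp only [rowExp_V, rowExp_C, th] <;> (try split_ifs) <;> omega

lemma quiverForm_rowExp_far (n : ℕ) {i k : ℤ} (h : i + 2 ≤ k ∨ k + 2 ≤ i) (r s : ℤ) :
    quiverForm n (rowExp i r) (rowExp k s) = 0 := by
  have aux : ∀ (w : ℤ) (p p' : Prop) [Decidable p] [Decidable p'], ¬ (p ∧ p') →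
      w * (if p then 1 else 0) * (if p' then 1 else 0) = 0 := by
    intro w p p' _ _ h
    split_ifs <;> simp_all
  rw [quiverForm_apply, sum_dnArrows]
  simp only [rowExp_Lam, rowExp_V, rowExp_C, mul_zero, zero_mul, add_zero]
  have add2 : ∀ {a b : ℤ}, a = 0 → b = 0 → a + b = 0 := by
    intros
    omega
  refine add2 (add2 (add2 (add2 ?_ ?_) ?_) ?_) ?_
  · exact Finset.sum_eq_zero fun a _ => Finset.sum_eq_zero fun c _ => aux _ _ _ (by omega)
  · exact Finset.sum_eq_zero fun a _ => Finset.sum_eq_zero fun c _ => aux _ _ _ (by omega)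
  · exact Finset.sum_eq_zero fun a _ => aux _ _ _ (by omega)
  · exact Finset.sum_eq_zero fun a _ => aux _ _ _ (by omega)
  · exact Finset.sum_eq_zero fun a _ => add2
      (Finset.sum_eq_zero fun c _ => aux _ _ _ (by omega))
      (Finset.sum_eq_zero fun c _ => aux _ _ _ (by omega))

lemma quiverForm_rowExp_down (n : ℕ) {i r s : ℤ} (hi : 1 ≤ i) (hin : i + 1 ≤ n) (hr : -i ≤ r)
    (hr' : r ≤ i - 1) (hs' : s ≤ i) :
    quiverForm n (rowExp i r) (rowExp (i + 1) s)
      = 2 * max 0 (min (min r s + 1) 0 + i) + 2 * max 0 (i - max (i - min (r + 1) s) 0) := by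
  rw [quiverForm_apply, sum_dnArrows]
  simp only [rowExp_Lam, rowExp_V, rowExp_C, mul_zero, zero_mul, add_zero]
  have aux : ∀ (w : ℤ) (p p' p'' : Prop) [Decidable p] [Decidable p'] [Decidable p''],
      (p ∧ p' ↔ p'') → w * (if p then 1 else 0) * (if p' then 1 else 0) = if p'' then w else 0 := by
    intro w p p' p'' _ _ _ h
    split_ifs <;> simp_all
  have aux0 : ∀ (w : ℤ) (p p' : Prop) [Decidable p] [Decidable p'], ¬ (p ∧ p') →
      w * (if p then 1 else 0) * (if p' then 1 else 0) = 0 := by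
    intro w p p' _ _ h
    split_ifs <;> simp_all
  have add5 : ∀ {a b c d e x y : ℤ}, a = 0 → b = x → c = 0 → d = 0 → e = y →
      a + b + c + d + e = x + y := by
    intros
    omega
  refine add5 ?_ ?_ ?_ ?_ ?_
  · exact Finset.sum_eq_zero fun a _ => Finset.sum_eq_zero fun c _ => aux0 _ _ _ (by omega)
  · rw [show min (min r s + 1) 0 + i
        = min ((n + min r s) + 1) (n : ℤ) - max (n - i) 0 by omega, ← sum_range_ite_interval]
    refine Finset.sum_congr rfl fun a ha => ?_
    rw [Finset.mem_range] at ha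
    refine ((Finset.sum_congr rfl fun (c : ℕ) _ => aux 2 _ _ ((c : ℤ) = n - i + a + 1 ∧
      (n - i ≤ (a : ℤ) ∧ (a : ℤ) ≤ n + min r s)) ?_).trans (sum_range_ite_eq _ _ _ _)).trans
      (if_congr ?_ rfl rfl)
    · omega
    push_cast
    omega
  · exact Finset.sum_eq_zero fun a _ => aux0 _ _ _ (by omega)
  · exact Finset.sum_eq_zero fun a _ => aux0 _ _ _ (by omega)
  · rw [show i - max (i - min (r + 1) s) 0
        = min ((i - 1) + 1) ((n - 1 : ℕ) : ℤ) - max (i - min (r + 1) s) 0 by omega,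
      ← sum_range_ite_interval]
    refine Finset.sum_congr rfl fun a ha => ?_
    rw [Finset.mem_range] at ha
    refine (congrArg₂ (· + ·) (Finset.sum_eq_zero fun c _ => aux0 _ _ _ ?_)
      ((Finset.sum_congr rfl fun (c : ℕ) _ => aux 2 _ _ ((c : ℤ) = i - 1 - a ∧
      (i - min (r + 1) s ≤ (a : ℤ) ∧ (a : ℤ) ≤ i - 1)) ?_).trans
      (sum_range_ite_eq _ _ _ _))).trans ((zero_add _).trans (if_congr ?_ rfl rfl))
    all_goals omega

lemma quiverForm_rowExp_up (n : ℕ) {i r s : ℤ} (hi : 1 ≤ i) (hin : i + 1 ≤ n) (hr : -i ≤ r)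
    (hr' : r ≤ i - 1) (hs : -(i + 1) ≤ s) (hs' : s ≤ i) :
    quiverForm n (rowExp (i + 1) s) (rowExp i r)
      = 2 * max 0 (min r s) + 1 + 2 * max 0 (min i (i + min r (s + 1))) := by
  rw [quiverForm_apply, sum_dnArrows]
  simp only [rowExp_Lam, rowExp_V, rowExp_C, mul_zero, zero_mul, add_zero]
  have aux : ∀ (w : ℤ) (p p' p'' : Prop) [Decidable p] [Decidable p'] [Decidable p''],
      (p ∧ p' ↔ p'') → w * (if p then 1 else 0) * (if p' then 1 else 0) = if p'' then w else 0 := by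
    intro w p p' p'' _ _ _ h
    split_ifs <;> simp_all
  have aux0 : ∀ (w : ℤ) (p p' : Prop) [Decidable p] [Decidable p'], ¬ (p ∧ p') →
      w * (if p then 1 else 0) * (if p' then 1 else 0) = 0 := by
    intro w p p' _ _ h
    split_ifs <;> simp_all
  have add5 : ∀ {a b c d e x y z : ℤ}, a = 0 → b = x → c = y → d = 0 → e = z →
      a + b + c + d + e = x + y + z := by
    intros
    omega
  refine add5 ?_ ?_ ?_ ?_ ?_
  · exact Finset.sum_eq_zero fun a _ => Finset.sum_eq_zero fun c _ => aux0 _ _ _ (by omega)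
  · rw [show max 0 (min r s)
        = max 0 (min ((n : ℤ) + 1) (n : ℤ) - max (n - min r s) 0) by omega,
      ← sum_range_ite_interval]
    refine Finset.sum_congr rfl fun a ha => ?_
    rw [Finset.mem_range] at ha
    refine ((Finset.sum_congr rfl fun (c : ℕ) _ => aux 2 _ _ ((c : ℤ) = i - n + a ∧
      (n - min r s ≤ (a : ℤ) ∧ (a : ℤ) ≤ n)) ?_).trans (sum_range_ite_eq _ _ _ _)).trans
      (if_congr ?_ rfl rfl)
    · omega
    push_cast
    omega
  · refine ((Finset.sum_congr rfl fun (a : ℕ) _ => aux 1 _ _ ((a : ℤ) = i - 1 ∧ True) ?_).trans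
      (sum_range_ite_eq _ _ _ _)).trans (if_pos ?_)
    all_goals simp only [and_true]; omega
  · exact Finset.sum_eq_zero fun a _ => aux0 _ _ _ (by omega)
  · rw [show min i (i + min r (s + 1))
        = min ((min (i - 1) (i - 1 + min r (s + 1))) + 1) ((n - 1 : ℕ) : ℤ) - max 0 0 by omega,
      ← sum_range_ite_interval]
    refine Finset.sum_congr rfl fun a ha => ?_
    rw [Finset.mem_range] at ha
    refine (congrArg₂ (· + ·)
      ((Finset.sum_congr rfl fun (c : ℕ) _ => aux 2 _ _ ((c : ℤ) = i - 1 - a ∧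
      (0 ≤ (a : ℤ) ∧ (a : ℤ) ≤ min (i - 1) (i - 1 + min r (s + 1)))) ?_).trans
      (sum_range_ite_eq _ _ _ _)) (Finset.sum_eq_zero fun c _ => aux0 _ _ _ ?_)).trans
      ((add_zero _).trans (if_congr ?_ rfl rfl))
    all_goals omega

end RowExponents

section RowCommutation

lemma quiverForm_rowExp_succ_pos (n : ℕ) {i r s : ℤ} (hi : 1 ≤ i) (hin : i + 1 ≤ n) (hr : -i ≤ r)
    (hr' : r ≤ i - 1) (hs' : s ≤ i) (hrs : r < s) :
    quiverForm n (rowExp i r) (rowExp (i + 1) s) - quiverForm n (rowExp (i + 1) s) (rowExp i r)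
      = 1 := by
  rw [quiverForm_rowExp_down n hi hin hr hr' hs',
    quiverForm_rowExp_up n hi hin hr hr' (by omega) hs']
  omega

lemma quiverForm_rowExp_succ_neg (n : ℕ) {i s : ℤ} (hi : 1 ≤ i) (hin : i + 1 ≤ n)
    (hs' : s ≤ i - 1) (hs : 0 ≤ s) :
    quiverForm n (rowExp i s) (rowExp (i + 1) s) - quiverForm n (rowExp (i + 1) s) (rowExp i s)
      = -1 := by
  rw [quiverForm_rowExp_down n hi hin (by omega) hs' (by omega),
    quiverForm_rowExp_up n hi hin (by omega) hs' (by omega) (by omega)]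
  omega

lemma rowExp_lt_rowExp {i r s : ℤ} (hr : -i ≤ r) (hrs : r < s) : rowExp i r < rowExp i s := by
  refine Pi.lt_def.2 ⟨?_, .V i s, ?_⟩
  · rintro (⟨a, c⟩ | a)
    · change (_ : ℤ) ≤ _
      rw [rowExp_V, rowExp_V]
      split_ifs <;> omega
    · exact le_rfl
  · rw [rowExp_V, rowExp_V, if_neg (by omega), if_pos (by omega)]
    exact one_pos

end RowCommutation

section RotHom

/-- The action of the rotation of the quiver on exponents. -/
def rotHom (n : ℕ) : (DnLabel → ℤ) →+ (DnLabel → ℤ) :=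
  AddMonoidHom.mk' (fun a => a ∘ rotLabel n) fun _ _ => rfl

lemma rotHom_apply (n : ℕ) (a : DnLabel → ℤ) (v : DnLabel) : rotHom n a v = a (rotLabel n v) := rfl

lemma rotHom_rotHom (n : ℕ) (a : DnLabel → ℤ) : rotHom n (rotHom n a) = a := by
  ext v
  rw [rotHom_apply, rotHom_apply, rotLabel_rotLabel]

lemma rotHom_lt {n : ℕ} {a b : DnLabel → ℤ} (h : a < b) : rotHom n a < rotHom n b := by
  obtain ⟨h1, v, hv⟩ := Pi.lt_def.1 h
  refine Pi.lt_def.2 ⟨fun w => h1 _, rotLabel n v, ?_⟩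
  rwa [rotHom_apply, rotHom_apply, rotLabel_rotLabel]

lemma quiverForm_rotHom (n : ℕ) (a b : DnLabel → ℤ) :
    quiverForm n (rotHom n a) (rotHom n b) = quiverForm n a b :=
  quiverForm_rot n a b

lemma rotHom_single {n : ℕ} {a : ℤ} (c : ℤ) (ha : a ≤ n) :
    rotHom n (Pi.single (.V a c) 1) = Pi.single (Lam n a c) 1 := by
  ext w
  rw [rotHom_apply, Pi.single_apply, Pi.single_apply]
  refine if_congr ⟨fun h => ?_, fun h => ?_⟩ rfl rfl
  · rw [← rotLabel_rotLabel n w, h, rotLabel_V c ha]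
  · rw [h, rotLabel_Lam c ha]

lemma sum_single_eq_rowExp (i r : ℤ) :
    ((List.range (r + i + 1).toNat).map fun k : ℕ =>
      (Pi.single (DnLabel.V i (-i + k)) 1 : DnLabel → ℤ)).sum = rowExp i r := by
  rw [list_sum_map_range]
  ext w
  rw [Finset.sum_apply]
  rcases w with ⟨a, c⟩ | a
  · rw [rowExp_V]
    refine (Finset.sum_congr rfl fun k _ => ?_).trans
      ((sum_range_ite_eq _ (c + i) 1 (a = i)).trans (if_congr ?_ rfl rfl))
    · rw [Pi.single_apply]
      refine if_congr ?_ rfl rfl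
      rw [DnLabel.V.injEq]
      omega
    · omega
  · rw [rowExp_C]
    exact Finset.sum_eq_zero fun k _ => by simp

lemma sum_single_Lam (n : ℕ) {i : ℤ} (r : ℤ) (hi : i ≤ n) :
    ((List.range (r + i + 1).toNat).map fun k : ℕ =>
      (Pi.single (Lam n i (-i + k)) 1 : DnLabel → ℤ)).sum = rotHom n (rowExp i r) := by
  rw [← sum_single_eq_rowExp, map_list_sum, List.map_map]
  simp only [Function.comp_def, rotHom_single _ hi]

end RotHom

section TorusHom

lemma qq_ne_zero : qq ≠ 0 := RatFunc.X_ne_zero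

lemma ii_ne_zero : ii ≠ 0 := by
  rw [ii, map_ne_zero_iff _ RatFunc.C_injective]
  exact Complex.I_ne_zero

lemma qq_pow_ne_one {m : ℕ} (hm : m ≠ 0) (c : ℂ) : qq ^ m ≠ RatFunc.C c := by
  rw [qq, ← RatFunc.algebraMap_X, ← map_pow, ← RatFunc.algebraMap_C]
  intro h
  have h := congrArg Polynomial.natDegree (RatFunc.algebraMap_injective ℂ h)
  rw [Polynomial.natDegree_X_pow, Polynomial.natDegree_C] at h
  exact hm h

lemma qq_mul_qq_ne_one : qq * qq ≠ 1 := by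
  rw [← pow_two, ← map_one RatFunc.C]
  exact qq_pow_ne_one two_ne_zero _

lemma qq_add_inv_ne_zero : qq + qq⁻¹ ≠ 0 := by
  intro h
  refine qq_pow_ne_one two_ne_zero (-1) ?_
  rw [map_neg, map_one, pow_two, eq_neg_iff_add_eq_zero]
  have := congrArg (qq * ·) h
  simpa [mul_add, qq_ne_zero] using this

lemma quiverForm_single (n : ℕ) (u v : DnLabel) :
    quiverForm n (Pi.single u 1) (Pi.single v 1) - quiverForm n (Pi.single v 1) (Pi.single u 1)
      = eps2 n v u := by
  rw [quiverForm_apply, quiverForm_apply, eps2, sub_eq_iff_eq_add, ← List.sum_map_add]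
  refine congrArg List.sum (List.map_congr_left fun a _ => ?_)
  have aux : ∀ (w : ℤ) (p p' r r' : Prop) [Decidable p] [Decidable p'] [Decidable r]
      [Decidable r'], w * (if p then 1 else 0) * (if p' then 1 else 0)
        = (if p' ∧ p then w else 0) - (if r' ∧ r then w else 0)
          + w * (if r then 1 else 0) * (if r' then 1 else 0) := by
    intros
    split_ifs <;> simp_all
  simp only [Pi.single_apply]
  exact aux _ _ _ _ _

/-- The representation of the quantum torus algebra by operators on the functions of exponents. -/
def torusHom (n : ℕ) :
    Dtorus n →ₐ[Kq] Module.End Kq ((DnLabel → ℤ) →₀ Kq) :=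
  RingQuot.liftAlgHom Kq ⟨FreeAlgebra.lift Kq (Sum.elim
    (fun v => torusOp qq (quiverForm n) (Pi.single v.1 1))
    (fun v => qq ^ quiverForm n (Pi.single v.1 1) (Pi.single v.1 1) •
      torusOp qq (quiverForm n) (-Pi.single v.1 1))), by
    have hX := isTorusRep_torusOp (B := quiverForm n) qq_ne_zero
    intro x y h
    induction h with
    | comm u v =>
      simp only [map_mul, map_smul, FreeAlgebra.lift_ι_apply, Sum.elim_inl]
      exact hX.qcomm qq_ne_zero (quiverForm_single n _ _)
    | mul_inv v =>
      simp only [map_mul, map_one, FreeAlgebra.lift_ι_apply, Sum.elim_inl, Sum.elim_inr]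
      rw [mul_smul_comm, hX.mul, smul_smul, ← zpow_add₀ qq_ne_zero, map_neg, add_neg_cancel,
        add_neg_cancel, zpow_zero, one_smul, hX.zero]
    | inv_mul v =>
      simp only [map_mul, map_one, FreeAlgebra.lift_ι_apply, Sum.elim_inl, Sum.elim_inr]
      rw [smul_mul_assoc, hX.mul, smul_smul, ← zpow_add₀ qq_ne_zero, map_neg,
        AddMonoidHom.neg_apply, add_neg_cancel, neg_add_cancel, zpow_zero, one_smul, hX.zero]⟩

lemma torusHom_Xg {n : ℕ} {v : DnLabel} (hv : v.valid n) :
    torusHom n (Xg n v) = torusOp qq (quiverForm n) (Pi.single v 1) := by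
  rw [Xg, dif_pos hv, torusHom, RingQuot.liftAlgHom_mkAlgHom_apply, FreeAlgebra.lift_ι_apply]
  rfl

lemma torusHom_prod (n : ℕ) (l : List DnLabel) (hl : ∀ v ∈ l, v.valid n) :
    ∃ c : Kq, c ≠ 0 ∧ torusHom n (l.map (Xg n)).prod
      = c • torusOp qq (quiverForm n) (l.map fun v => Pi.single v 1).sum := by
  have hX := isTorusRep_torusOp (B := quiverForm n) qq_ne_zero
  induction l with
  | nil => exact ⟨1, one_ne_zero, by simp [hX.zero]⟩
  | cons v l ih =>
    obtain ⟨c, hc, h⟩ := ih fun w hw => hl w (List.mem_cons_of_mem _ hw)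
    refine ⟨c * qq ^ quiverForm n (Pi.single v 1) (l.map fun v => Pi.single v 1).sum,
      mul_ne_zero hc (zpow_ne_zero _ qq_ne_zero), ?_⟩
    rw [List.map_cons, List.prod_cons, map_mul, h, torusHom_Xg (hl v List.mem_cons_self),
      mul_smul_comm, hX.mul, smul_smul, List.map_cons, List.sum_cons]

lemma torusHom_Vprod {n : ℕ} {i r : ℤ} (hi : 1 ≤ i) (hin : i ≤ n) (hr : r ≤ i) :
    ∃ c : Kq, c ≠ 0 ∧ torusHom n (Vprod n i r) = c • torusOp qq (quiverForm n) (rowExp i r) := by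
  obtain ⟨c, hc, h⟩ := torusHom_prod n
    ((List.range (r + i + 1).toNat).map fun k : ℕ => DnLabel.V i (-i + k)) (by
      intro v hv
      obtain ⟨k, hk, rfl⟩ := List.mem_map.1 hv
      rw [List.mem_range] at hk
      simp only [DnLabel.valid]
      omega)
  refine ⟨c, hc, ?_⟩
  rw [List.map_map, List.map_map] at h
  rw [← sum_single_eq_rowExp]
  simp only [Vprod, List.bind_eq_flatMap, List.pure_def, flatMap_singleton_eq_map, List.map_map]
  exact h

lemma torusHom_Lprod {n : ℕ} {i r : ℤ} (hi : 1 ≤ i) (hin : i ≤ n) (hr : r ≤ i) :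
    ∃ c : Kq, c ≠ 0 ∧ torusHom n (Lprod n i r)
      = c • torusOp qq (quiverForm n) (rotHom n (rowExp i r)) := by
  obtain ⟨c, hc, h⟩ := torusHom_prod n
    ((List.range (r + i + 1).toNat).map fun k : ℕ => Lam n i (-i + k)) (by
      intro v hv
      obtain ⟨k, hk, rfl⟩ := List.mem_map.1 hv
      rw [List.mem_range] at hk
      rw [Lam]
      split_ifs <;> simp only [DnLabel.valid, th] <;> omega)
  refine ⟨c, hc, ?_⟩
  rw [List.map_map, List.map_map] at h
  rw [← sum_single_Lam n r hin]
  simp only [Lprod, List.bind_eq_flatMap, List.pure_def, flatMap_singleton_eq_map, List.map_map]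
  exact h

end TorusHom

section RootOrder

lemma mem_rootIdx {n d : ℕ} (hd : d ≤ n) {p : ℕ × ℕ} (hp : p ∈ rootIdx n d) :
    n - d ≤ p.1 ∧ p.1 + p.2 < n := by
  induction d with
  | zero => simp [rootIdx] at hp
  | succ d ih =>
    rw [rootIdx, List.mem_append, List.mem_map] at hp
    rcases hp with hp | ⟨t, ht, rfl⟩
    · have := ih (by omega) hp
      omega
    · rw [List.mem_reverse, List.mem_range] at ht
      dsimp only
      omega

lemma pairwise_rootIdx {n d : ℕ} (hd : d ≤ n) :
    (rootIdx n d).Pairwise fun p p' => ¬ (p'.1 = p.1 ∧ p.2 ≤ p'.2) := by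
  induction d with
  | zero => exact List.Pairwise.nil
  | succ d ih =>
    rw [rootIdx, List.pairwise_append]
    refine ⟨ih (by omega), ?_, ?_⟩
    · rw [List.pairwise_map, List.pairwise_reverse]
      refine List.pairwise_lt_range.imp fun h => ?_
      dsimp only
      omega
    · intro p hp p' hp'
      obtain ⟨t, ht, rfl⟩ := List.mem_map.1 hp'
      have := mem_rootIdx (by omega) hp
      dsimp only
      omega

end RootOrder

section LeadFunctionals

/-- The difference of the coordinates at `V_{k,l}` and, for positive `l`, at `Λ_{θ(l),0}`. -/
def centreDiff (n : ℕ) (k l : ℤ) : (DnLabel → ℤ) →+ ℤ :=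
  AddMonoidHom.mk' (fun x => x (.V k l) - if 0 < l then x (.C (n + 1 - l)) else 0) fun x y => by
    simp only [Pi.add_apply]
    split_ifs <;> ring

lemma centreDiff_rowExp (n : ℕ) (k l i r : ℤ) :
    centreDiff n k l (rowExp i r) = if k = i ∧ -i ≤ l ∧ l ≤ r then 1 else 0 := by
  simp [centreDiff, rowExp_V, rowExp_C]

lemma centreDiff_rotHom_rowExp {n : ℕ} {k l i r : ℤ} (hkn : k ≤ n) (hl : 0 ≤ l)
    (hlk : l ≤ k) (hr : 0 ≤ r) : centreDiff n k l (rotHom n (rowExp i r)) = 0 := by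
  change rotHom n (rowExp i r) (.V k l)
    - (if 0 < l then rotHom n (rowExp i r) (.C (n + 1 - l)) else 0) = 0
  rw [rotHom_apply, rotHom_apply]
  rcases hl.eq_or_lt with rfl | hl
  · rw [rotLabel_V_zero hkn, rowExp_C, if_neg (by omega), sub_zero]
  · rw [rotLabel_V_pos hkn hl, rotLabel_C (by omega), rowExp_V, rowExp_V]
    split_ifs <;> omega

/-- The leading exponents of the root vectors and of the torus part of one Borel half. -/
def halfLead : (ℕ × ℕ) ⊕ ℕ → DnLabel → ℤ
  | .inl p => ∑ i ∈ Finset.range (p.2 + 1), rowExp ((p.1 + i : ℕ) + 1) p.1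
  | .inr i => rowExp ((i : ℤ) + 1) ((i : ℤ) + 1)

/-- The functionals separating the exponents `halfLead`. -/
def halfFun (n : ℕ) : (ℕ × ℕ) ⊕ ℕ → (DnLabel → ℤ) →+ ℤ
  | .inl p => centreDiff n (p.1 + p.2 + 1) p.1 - centreDiff n (p.1 + p.2 + 1) (p.1 + 1)
  | .inr i => centreDiff n (i + 1) (i + 1)

lemma halfFun_inl (n : ℕ) (p : ℕ × ℕ) (x : DnLabel → ℤ) : halfFun n (.inl p) x
    = centreDiff n (p.1 + p.2 + 1) p.1 x - centreDiff n (p.1 + p.2 + 1) (p.1 + 1) x := rfl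

lemma halfFun_inl_inl (n : ℕ) (p p' : ℕ × ℕ) : halfFun n (.inl p) (halfLead (.inl p'))
    = if p'.1 = p.1 ∧ p.2 ≤ p'.2 then 1 else 0 := by
  rw [halfFun_inl, halfLead, map_sum, map_sum, ← Finset.sum_sub_distrib]
  refine (Finset.sum_congr rfl fun (i : ℕ) _ => ?_).trans
    ((sum_range_ite_eq _ (p.2 : ℤ) 1 (p'.1 = p.1)).trans (if_congr ?_ rfl rfl))
  · rw [centreDiff_rowExp, centreDiff_rowExp]
    split_ifs <;> omega
  · omega

lemma halfFun_inl_inr (n : ℕ) (p : ℕ × ℕ) (i : ℕ) :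
    halfFun n (.inl p) (halfLead (.inr i)) = 0 := by
  rw [halfFun_inl, halfLead, centreDiff_rowExp, centreDiff_rowExp]
  split_ifs <;> omega

lemma halfFun_inr_inl (n : ℕ) (i : ℕ) (p : ℕ × ℕ) :
    halfFun n (.inr i) (halfLead (.inl p)) = 0 := by
  rw [halfFun, halfLead, map_sum]
  refine Finset.sum_eq_zero fun k _ => ?_
  rw [centreDiff_rowExp]
  exact if_neg (by omega)

lemma halfFun_inr_inr (n : ℕ) (i j : ℕ) :
    halfFun n (.inr i) (halfLead (.inr j)) = if i = j then 1 else 0 := by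
  rw [halfFun, halfLead, centreDiff_rowExp]
  exact if_congr (by omega) rfl rfl

/-- The range of the indices of `halfLead`. -/
def halfValid (n : ℕ) : (ℕ × ℕ) ⊕ ℕ → Prop
  | .inl p => p.1 + p.2 < n
  | .inr i => i < n

lemma halfFun_self (n : ℕ) (s : (ℕ × ℕ) ⊕ ℕ) : halfFun n s (halfLead s) = 1 := by
  rcases s with p | i
  · rw [halfFun_inl_inl, if_pos ⟨rfl, le_rfl⟩]
  · rw [halfFun_inr_inr, if_pos rfl]

lemma halfFun_rotHom {n : ℕ} {s : (ℕ × ℕ) ⊕ ℕ} (hs : halfValid n s) (s' : (ℕ × ℕ) ⊕ ℕ) :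
    halfFun n s (rotHom n (halfLead s')) = 0 := by
  have key : ∀ k l : ℤ, k ≤ n → 0 ≤ l → l ≤ k →
      centreDiff n k l (rotHom n (halfLead s')) = 0 := by
    intro k l h2 h3 h4
    rcases s' with p | i
    · rw [halfLead, map_sum, map_sum]
      exact Finset.sum_eq_zero fun i _ => centreDiff_rotHom_rowExp h2 h3 h4 (by omega)
    · exact centreDiff_rotHom_rowExp h2 h3 h4 (by omega)
  rcases s with p | i
  · have hs : p.1 + p.2 < n := hs
    rw [halfFun_inl, key _ _ (by omega) (by omega) (by omega),
      key _ _ (by omega) (by omega) (by omega), sub_zero]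
  · have hs : i < n := hs
    exact key _ _ (by omega) (by omega) (by omega)

/-- The leading exponents for both Borel halves; the rotation exchanges the halves. -/
def lead (n : ℕ) (s : Bool × ((ℕ × ℕ) ⊕ ℕ)) : DnLabel → ℤ :=
  if s.1 then rotHom n (halfLead s.2) else halfLead s.2

/-- The functionals separating the exponents `lead`. -/
def leadFun (n : ℕ) (s : Bool × ((ℕ × ℕ) ⊕ ℕ)) : (DnLabel → ℤ) →+ ℤ :=
  if s.1 then (halfFun n s.2).comp (rotHom n) else halfFun n s.2

lemma leadFun_lead (n : ℕ) (b : Bool) (s s' : (ℕ × ℕ) ⊕ ℕ) :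
    leadFun n (b, s) (lead n (b, s')) = halfFun n s (halfLead s') := by
  cases b
  · rfl
  · exact congrArg (halfFun n s) (rotHom_rotHom n _)

lemma leadFun_lead_self_ne_zero (n : ℕ) (s : Bool × ((ℕ × ℕ) ⊕ ℕ)) :
    leadFun n s (lead n s) ≠ 0 := by
  obtain ⟨b, s⟩ := s
  rw [leadFun_lead, halfFun_self]
  exact one_ne_zero

lemma leadFun_lead_of_ne {n : ℕ} {b b' : Bool} (hb : b ≠ b') {s : (ℕ × ℕ) ⊕ ℕ}
    (hs : halfValid n s) (s' : (ℕ × ℕ) ⊕ ℕ) : leadFun n (b, s) (lead n (b', s')) = 0 := by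
  cases b <;> cases b'
  · exact absurd rfl hb
  · exact halfFun_rotHom hs s'
  · exact halfFun_rotHom hs s'
  · exact absurd rfl hb

/-- The indices of a Poincaré–Birkhoff–Witt basis, ordered by the triangular decomposition. -/
def leadIdx (n : ℕ) : List (Bool × ((ℕ × ℕ) ⊕ ℕ)) :=
  (rootIdx n n).map (fun p => (true, .inl p))
    ++ ((List.range n).map (fun i => (true, .inr i))
      ++ (List.range n).map (fun i => (false, .inr i)))
    ++ (rootIdx n n).map (fun p => (false, .inl p))

lemma halfValid_of_mem_leadIdx {n : ℕ} {s : Bool × ((ℕ × ℕ) ⊕ ℕ)} (hs : s ∈ leadIdx n) :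
    halfValid n s.2 := by
  simp only [leadIdx, List.mem_append, List.mem_map, List.mem_range] at hs
  rcases hs with (⟨p, hp, rfl⟩ | ⟨i, hi, rfl⟩ | ⟨i, hi, rfl⟩) | ⟨p, hp, rfl⟩
  · exact (mem_rootIdx le_rfl hp).2
  · exact hi
  · exact hi
  · exact (mem_rootIdx le_rfl hp).2

lemma pairwise_leadIdx (n : ℕ) :
    (leadIdx n).Pairwise fun s t => leadFun n s (lead n t) = 0 := by
  have h1 : ∀ b : Bool, ((rootIdx n n).map fun p => ((b, .inl p) : Bool × ((ℕ × ℕ) ⊕ ℕ))).Pairwise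
      fun s t => leadFun n s (lead n t) = 0 := by
    intro b
    rw [List.pairwise_map]
    refine (pairwise_rootIdx le_rfl).imp fun h => ?_
    rw [leadFun_lead, halfFun_inl_inl, if_neg h]
  have h2 : ∀ b : Bool, ((List.range n).map fun i => ((b, .inr i) : Bool × ((ℕ × ℕ) ⊕ ℕ))).Pairwise
      fun s t => leadFun n s (lead n t) = 0 := by
    intro b
    rw [List.pairwise_map]
    refine List.pairwise_lt_range.imp fun h => ?_
    rw [leadFun_lead, halfFun_inr_inr, if_neg h.ne]
  have h3 : ∀ (b b' : Bool) (s t : (ℕ × ℕ) ⊕ ℕ), halfValid n s →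
      (b = b' → halfFun n s (halfLead t) = 0) → leadFun n (b, s) (lead n (b', t)) = 0 := by
    intro b b' s t hs h
    by_cases hb : b = b'
    · rw [← hb, leadFun_lead, h hb]
    · exact leadFun_lead_of_ne hb hs t
  refine List.pairwise_append.2 ⟨List.pairwise_append.2 ⟨h1 _, List.pairwise_append.2
    ⟨h2 _, h2 _, ?_⟩, ?_⟩, h1 _, ?_⟩
  · intro s hs t ht
    obtain ⟨i, hi, rfl⟩ := List.mem_map.1 hs
    obtain ⟨i', -, rfl⟩ := List.mem_map.1 ht
    exact h3 _ _ _ _ (List.mem_range.1 hi) (by simp)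
  · intro s hs t ht
    obtain ⟨p, hp, rfl⟩ := List.mem_map.1 hs
    rcases List.mem_append.1 ht with ht | ht <;> obtain ⟨i, -, rfl⟩ := List.mem_map.1 ht <;>
      exact h3 _ _ _ _ (mem_rootIdx le_rfl hp).2 fun _ => halfFun_inl_inr n p i
  · intro s hs t ht
    obtain ⟨p', -, rfl⟩ := List.mem_map.1 ht
    rcases List.mem_append.1 hs with hs | hs
    · obtain ⟨p, hp, rfl⟩ := List.mem_map.1 hs
      exact h3 _ _ _ _ (mem_rootIdx le_rfl hp).2 (by simp)
    · rcases List.mem_append.1 hs with hs | hs <;> obtain ⟨i, hi, rfl⟩ := List.mem_map.1 hs <;>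
        exact h3 _ _ _ _ (List.mem_range.1 hi) fun _ => halfFun_inr_inl n i p'

end LeadFunctionals

section Triangular

open Algebra

variable {k A : Type*} [Field k] [Ring A] [Algebra k A]

lemma units_inv_qcomm {u : Aˣ} {x : A} {c : k} (h : u * x = c • (x * u)) :
    x * ((u⁻¹ : Aˣ) : A) = c • (((u⁻¹ : Aˣ) : A) * x) := by
  have := congrArg (fun y => ((u⁻¹ : Aˣ) : A) * y * ((u⁻¹ : Aˣ) : A)) h
  simpa [mul_assoc] using this

lemma units_qcomm {u : Aˣ} {x : A} {c : k} (hc : c ≠ 0) (h : u * x = c • (x * u)) :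
    x * u = c⁻¹ • (u * x) := by
  rw [h, smul_smul, inv_mul_cancel₀ hc, one_smul]

lemma units_inv_qcomm' {u : Aˣ} {x : A} {c : k} (hc : c ≠ 0) (h : u * x = c • (x * u)) :
    ((u⁻¹ : Aˣ) : A) * x = c⁻¹ • (x * ((u⁻¹ : Aˣ) : A)) := by
  rw [units_inv_qcomm h, smul_smul, inv_mul_cancel₀ hc, one_smul]

/-- Triangular decomposition: if the generators `f`, `t`, `e` can be reordered, the algebra is
spanned by ordered products. -/
lemma triangular_decomposition {F T E : Set A}
    (hEF : ∀ e ∈ E, ∀ f ∈ F, e * f - f * e ∈ adjoin k T)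
    (hET : ∀ e ∈ E, ∀ t ∈ T, ∃ c : k, e * t = c • (t * e))
    (hTF : ∀ t ∈ T, ∀ f ∈ F, ∃ c : k, t * f = c • (f * t))
    (hgen : adjoin k (F ∪ T ∪ E) = ⊤) :
    Subalgebra.toSubmodule (adjoin k F) * Subalgebra.toSubmodule (adjoin k T)
      * Subalgebra.toSubmodule (adjoin k E) = ⊤ := by
  have hFl : ∀ f ∈ F, ∀ τ ∈ adjoin k T, ∃ τ' ∈ adjoin k T, f * τ' = τ * f := by
    intro f hf τ hτ
    have : τ * f ∈ (Subalgebra.toSubmodule (adjoin k T)).map (LinearMap.mulLeft k f) := by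
      refine adjoin_mul_mem ?_ hτ ⟨1, (adjoin k T).one_mem, mul_one f⟩
      rintro t ht _ ⟨y, hy, rfl⟩
      obtain ⟨c, hc⟩ := hTF t ht f hf
      refine ⟨c • (t * y), Subalgebra.smul_mem _ (mul_mem (subset_adjoin ht) hy) _, ?_⟩
      rw [LinearMap.mulLeft_apply, LinearMap.mulLeft_apply, ← mul_assoc, hc, mul_smul_comm,
        smul_mul_assoc, mul_assoc]
    exact this
  have hEr : ∀ e ∈ E, ∀ τ ∈ adjoin k T, ∃ τ' ∈ adjoin k T, τ' * e = e * τ := by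
    intro e he τ hτ
    have : e * τ ∈ (Subalgebra.toSubmodule (adjoin k T)).map (LinearMap.mulRight k e) := by
      refine mul_adjoin_mem ?_ hτ ⟨1, (adjoin k T).one_mem, one_mul e⟩
      rintro t ht _ ⟨y, hy, rfl⟩
      obtain ⟨c, hc⟩ := hET e he t ht
      refine ⟨c • (y * t), Subalgebra.smul_mem _ (mul_mem hy (subset_adjoin ht)) _, ?_⟩
      rw [LinearMap.mulRight_apply, LinearMap.mulRight_apply, mul_assoc y e t, hc, mul_smul_comm,
        smul_mul_assoc, mul_assoc]
    exact this
  have hTr : ∀ t ∈ T, ∀ y ∈ adjoin k E, ∃ y' ∈ adjoin k E, t * y' = y * t := by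
    intro t ht y hy
    have : y * t ∈ (Subalgebra.toSubmodule (adjoin k E)).map (LinearMap.mulLeft k t) := by
      refine adjoin_mul_mem ?_ hy ⟨1, (adjoin k E).one_mem, mul_one t⟩
      rintro e he _ ⟨z, hz, rfl⟩
      obtain ⟨c, hc⟩ := hET e he t ht
      refine ⟨c • (e * z), Subalgebra.smul_mem _ (mul_mem (subset_adjoin he) hz) _, ?_⟩
      rw [LinearMap.mulLeft_apply, LinearMap.mulLeft_apply, ← mul_assoc, hc, mul_smul_comm,
        smul_mul_assoc, mul_assoc]
    exact this
  have hFr : ∀ f ∈ F, ∀ y ∈ adjoin k E,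
      y * f ∈ (Subalgebra.toSubmodule (adjoin k E)).map (LinearMap.mulLeft k f)
        ⊔ Subalgebra.toSubmodule (adjoin k T) * Subalgebra.toSubmodule (adjoin k E) := by
    intro f hf y hy
    refine adjoin_mul_mem ?_ hy (Submodule.mem_sup_left ⟨1, (adjoin k E).one_mem, mul_one f⟩)
    intro e he z hz
    obtain ⟨_, ⟨a, ha, rfl⟩, b, hb, rfl⟩ := Submodule.mem_sup.1 hz
    rw [mul_add]
    refine Submodule.add_mem _ ?_ (Submodule.mem_sup_right ?_)
    · rw [LinearMap.mulLeft_apply, ← mul_assoc, ← sub_add_cancel (e * f) (f * e), add_mul]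
      refine Submodule.add_mem _ (Submodule.mem_sup_right ?_) (Submodule.mem_sup_left ?_)
      · exact Submodule.mul_mem_mul (hEF e he f hf) ha
      · exact ⟨e * a, (adjoin k E).mul_mem (subset_adjoin he) ha, (mul_assoc _ _ _).symm⟩
    · clear hz
      induction hb using Submodule.mul_induction_on' with
      | mem_mul_mem τ hτ w hw =>
        obtain ⟨τ', hτ', h⟩ := hEr e he τ hτ
        rw [← mul_assoc, ← h, mul_assoc]
        exact Submodule.mul_mem_mul hτ' ((adjoin k E).mul_mem (subset_adjoin he) hw)
      | add u _ v _ hu hv => rw [mul_add]; exact Submodule.add_mem _ hu hv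
  set M := Subalgebra.toSubmodule (adjoin k F) * Subalgebra.toSubmodule (adjoin k T)
    * Subalgebra.toSubmodule (adjoin k E) with hM
  have hmem : ∀ φ ∈ adjoin k F, ∀ τ ∈ adjoin k T, ∀ y ∈ adjoin k E, φ * τ * y ∈ M :=
    fun φ hφ τ hτ y hy => Submodule.mul_mem_mul (Submodule.mul_mem_mul hφ hτ) hy
  have hind : ∀ a : A, (∀ φ ∈ adjoin k F, ∀ τ ∈ adjoin k T, ∀ y ∈ adjoin k E,
      φ * τ * y * a ∈ M) → ∀ x ∈ M, x * a ∈ M := by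
    intro a h x hx
    induction hx using Submodule.mul_induction_on' with
    | mem_mul_mem m hm y hy =>
      induction hm using Submodule.mul_induction_on' with
      | mem_mul_mem φ hφ τ hτ => exact h φ hφ τ hτ y hy
      | add u _ v _ hu hv => rw [add_mul, add_mul]; exact M.add_mem hu hv
    | add u _ v _ hu hv => rw [add_mul]; exact M.add_mem hu hv
  refine top_unique fun x _ => ?_
  have hx : x ∈ adjoin k (F ∪ T ∪ E) := hgen ▸ Algebra.mem_top
  rw [← one_mul x]
  refine mul_adjoin_mem ?_ hx (by simpa using hmem 1 (one_mem _) 1 (one_mem _) 1 (one_mem _))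
  rintro a ((ha | ha) | ha) <;> refine hind a fun φ hφ τ hτ y hy => ?_
  · obtain ⟨_, ⟨y', hy', rfl⟩, b, hb, h⟩ := Submodule.mem_sup.1 (hFr a ha y hy)
    obtain ⟨τ', hτ', h'⟩ := hFl a ha τ hτ
    rw [mul_assoc, ← h, mul_add, LinearMap.mulLeft_apply, ← mul_assoc, mul_assoc φ τ a, ← h',
      ← mul_assoc φ a τ']
    refine M.add_mem (hmem _ (mul_mem hφ (subset_adjoin ha)) _ hτ' _ hy') ?_
    clear h
    induction hb using Submodule.mul_induction_on' with
    | mem_mul_mem σ hσ w hw =>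
      rw [← mul_assoc, mul_assoc φ]
      exact hmem _ hφ _ (mul_mem hτ hσ) _ hw
    | add u _ v _ hu hv => rw [mul_add]; exact M.add_mem hu hv
  · obtain ⟨y', hy', h⟩ := hTr a ha y hy
    rw [mul_assoc, ← h, ← mul_assoc, mul_assoc φ]
    exact hmem _ hφ _ (mul_mem hτ (subset_adjoin ha)) _ hy'
  · rw [mul_assoc]
    exact hmem _ hφ _ hτ _ (mul_mem hy (subset_adjoin ha))

end Triangular

section DoubleGenerators

open Algebra

variable (n : ℕ)

lemma mkAlgHom_ddg (g : DDGen n) : RingQuot.mkAlgHom Kq (DDRel n) (ddg n g) = DDgen n g := rfl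

/-- `K_i` as a unit. -/
def unitK (i : Idx n) : (DDalg n)ˣ where
  val := DDgen n (.K i)
  inv := DDgen n (.Kinv i)
  val_inv := by
    simpa only [map_mul, map_one, mkAlgHom_ddg] using RingQuot.mkAlgHom_rel Kq (DDRel.K_Kinv i)
  inv_val := by
    simpa only [map_mul, map_one, mkAlgHom_ddg] using RingQuot.mkAlgHom_rel Kq (DDRel.Kinv_K i)

/-- `K_i'` as a unit. -/
def unitK' (i : Idx n) : (DDalg n)ˣ where
  val := DDgen n (.K' i)
  inv := DDgen n (.K'inv i)
  val_inv := by
    simpa only [map_mul, map_one, mkAlgHom_ddg] using RingQuot.mkAlgHom_rel Kq (DDRel.K'_K'inv i)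
  inv_val := by
    simpa only [map_mul, map_one, mkAlgHom_ddg] using RingQuot.mkAlgHom_rel Kq (DDRel.K'inv_K' i)

lemma thIdx_thIdx (i : Idx n) : thIdx n (thIdx n i) = i := by
  refine Subtype.ext ?_
  simp [thIdx, th]

/-- The index `t + 1`. -/
def idxSucc {t : ℕ} (ht : t < n) : Idx n := ⟨(t : ℤ) + 1, by omega, by omega⟩

lemma exists_idxSucc (i : Idx n) : ∃ (t : ℕ) (ht : t < n), idxSucc n ht = i := by
  obtain ⟨i, h1, h2⟩ := i
  refine ⟨(i - 1).toNat, by omega, Subtype.ext ?_⟩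
  simp only [idxSucc]
  omega

/-- The generators `E_i` (for `b = false`) and `F_{θ(i)}` (for `b = true`). -/
def rootGen (b : Bool) (i : Idx n) : DDalg n :=
  if b then DDgen n (.F (thIdx n i)) else DDgen n (.E i)

/-- The generators `K_i` (for `b = false`) and `K_{θ(i)}'` (for `b = true`) as units. -/
def torusGen (b : Bool) (i : Idx n) : (DDalg n)ˣ :=
  if b then unitK' n (thIdx n i) else unitK n i

/-- The generators `rootGen`, extended by zero to a sequence. -/
def rootSeq (b : Bool) (t : ℕ) : DDalg n :=
  if h : t < n then rootGen n b (idxSucc n h) else 0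

/-- The generators `torusGen`, extended by one to a sequence. -/
def torusSeq (b : Bool) (t : ℕ) : (DDalg n)ˣ :=
  if h : t < n then torusGen n b (idxSucc n h) else 1

lemma rootGen_comm (b : Bool) {i j : Idx n} (h : 1 < (i.1 - j.1).natAbs) :
    Commute (rootGen n b i) (rootGen n b j) := by
  cases b
  · have := RingQuot.mkAlgHom_rel Kq (DDRel.EEc i j h)
    simp only [map_mul, mkAlgHom_ddg] at this
    exact this
  · have h : 1 < ((thIdx n i).1 - (thIdx n j).1).natAbs := by
      simp only [thIdx, th]
      omega
    have := RingQuot.mkAlgHom_rel Kq (DDRel.FFc _ _ h)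
    simp only [map_mul, mkAlgHom_ddg] at this
    exact this

lemma rootGen_serre (b : Bool) {i j : Idx n} (h : (i.1 - j.1).natAbs = 1) :
    rootGen n b i * rootGen n b i * rootGen n b j
        + rootGen n b j * (rootGen n b i * rootGen n b i)
      = (qq + qq⁻¹) • (rootGen n b i * rootGen n b j * rootGen n b i) := by
  cases b
  · have := RingQuot.mkAlgHom_rel Kq (DDRel.serreE i j h)
    simp only [map_mul, map_add, map_smul, mkAlgHom_ddg] at this
    exact this
  · have h : ((thIdx n i).1 - (thIdx n j).1).natAbs = 1 := by
      simp only [thIdx, th]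
      omega
    have := RingQuot.mkAlgHom_rel Kq (DDRel.serreF _ _ h)
    simp only [map_mul, map_add, map_smul, mkAlgHom_ddg] at this
    exact this

lemma rootSeq_of_lt (b : Bool) {t : ℕ} (h : t < n) : rootSeq n b t = rootGen n b (idxSucc n h) :=
  dif_pos h

lemma rootSeq_of_le (b : Bool) {t : ℕ} (h : n ≤ t) : rootSeq n b t = 0 :=
  dif_neg h.not_gt

lemma torusSeq_of_lt (b : Bool) {t : ℕ} (h : t < n) :
    torusSeq n b t = torusGen n b (idxSucc n h) :=
  dif_pos h

lemma isSerreSeq_rootSeq (b : Bool) : IsSerreSeq qq (rootSeq n b) where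
  comm i j h := by
    rcases lt_or_ge j n with hj | hj
    · rw [rootSeq_of_lt n b hj, rootSeq_of_lt n b (by omega : i < n)]
      refine rootGen_comm n b ?_
      simp only [idxSucc]
      omega
    · rw [rootSeq_of_le n b hj]
      exact Commute.zero_right _
  serre_succ i := by
    rcases lt_or_ge (i + 1) n with hj | hj
    · rw [rootSeq_of_lt n b hj, rootSeq_of_lt n b (by omega : i < n)]
      refine rootGen_serre n b ?_
      simp only [idxSucc]
      omega
    · simp [rootSeq_of_le n b hj]
  serre_pred i := by
    rcases lt_or_ge (i + 1) n with hj | hj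
    · rw [rootSeq_of_lt n b hj, rootSeq_of_lt n b (by omega : i < n)]
      refine rootGen_serre n b ?_
      simp only [idxSucc]
      omega
    · simp [rootSeq_of_le n b hj]

lemma torusGen_rootGen (b b' : Bool) (i j : Idx n) : ∃ c : Kq, c ≠ 0 ∧
    (torusGen n b i : DDalg n) * rootGen n b' j = c • (rootGen n b' j * torusGen n b i) := by
  have aux : ∀ {x y : DDGen n} {z : ℤ}, DDRel n (ddg n x * ddg n y)
      (qq ^ z • (ddg n y * ddg n x)) → ∃ c : Kq, c ≠ 0 ∧
      DDgen n x * DDgen n y = c • (DDgen n y * DDgen n x) := by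
    intro x y z h
    exact ⟨qq ^ z, zpow_ne_zero _ qq_ne_zero, by
      simpa only [map_mul, map_smul, mkAlgHom_ddg] using RingQuot.mkAlgHom_rel Kq h⟩
  cases b <;> cases b'
  · exact aux (DDRel.KE i j)
  · exact aux (DDRel.KF i _)
  · exact aux (DDRel.K'E _ j)
  · exact aux (DDRel.K'F _ _)

lemma torusSeq_rootSeq (b b' : Bool) (i j : ℕ) : ∃ c : Kq, c ≠ 0 ∧
    (torusSeq n b i : DDalg n) * rootSeq n b' j = c • (rootSeq n b' j * torusSeq n b i) := by
  unfold torusSeq rootSeq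
  split_ifs
  · exact torusGen_rootGen n _ _ _ _
  · exact ⟨1, one_ne_zero, by simp⟩
  · exact ⟨1, one_ne_zero, by simp⟩
  · exact ⟨1, one_ne_zero, by simp⟩

lemma torusGen_comm (b b' : Bool) (i j : Idx n) : Commute (torusGen n b i) (torusGen n b' j) := by
  have aux : ∀ {x y : DDGen n}, DDRel n (ddg n x * ddg n y) (ddg n y * ddg n x) →
      DDgen n x * DDgen n y = DDgen n y * DDgen n x := by
    intro x y h
    simpa only [map_mul, mkAlgHom_ddg] using RingQuot.mkAlgHom_rel Kq h
  refine Units.ext ?_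
  cases b <;> cases b'
  · exact aux (DDRel.KK i j)
  · exact aux (DDRel.KK' i _)
  · exact (aux (DDRel.KK' j _)).symm
  · exact aux (DDRel.K'K' _ _)

lemma torusSeq_comm (b b' : Bool) (i j : ℕ) : Commute (torusSeq n b i) (torusSeq n b' j) := by
  unfold torusSeq
  split_ifs
  · exact torusGen_comm n _ _ _ _
  · exact Commute.one_right _
  · exact Commute.one_left _
  · exact Commute.one_left _

/-- The generators of the torus part. -/
def torusSet : Set (DDalg n) :=
  {x | ∃ (b : Bool) (t : ℕ), t < n ∧
    (x = torusSeq n b t ∨ x = ((torusSeq n b t)⁻¹ : (DDalg n)ˣ))}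

lemma torusGen_mem (b : Bool) (i : Idx n) : (torusGen n b i : DDalg n) ∈ torusSet n := by
  obtain ⟨t, ht, rfl⟩ := exists_idxSucc n i
  exact ⟨b, t, ht, .inl (by rw [torusSeq_of_lt n b ht])⟩

lemma torusGen_inv_mem (b : Bool) (i : Idx n) :
    (((torusGen n b i)⁻¹ : (DDalg n)ˣ) : DDalg n) ∈ torusSet n := by
  obtain ⟨t, ht, rfl⟩ := exists_idxSucc n i
  exact ⟨b, t, ht, .inr (by rw [torusSeq_of_lt n b ht])⟩

lemma rootGen_mem (b : Bool) (i : Idx n) : rootGen n b i ∈ Set.range (rootSeq n b) := by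
  obtain ⟨t, ht, rfl⟩ := exists_idxSucc n i
  exact ⟨t, rootSeq_of_lt n b ht⟩

lemma DDgen_mem (g : DDGen n) :
    DDgen n g ∈ Set.range (rootSeq n true) ∪ torusSet n ∪ Set.range (rootSeq n false) := by
  cases g with
  | E i => exact .inr (rootGen_mem n false i)
  | F i =>
    have := rootGen_mem n true (thIdx n i)
    rw [rootGen, if_pos rfl, thIdx_thIdx] at this
    exact .inl (.inl this)
  | K i => exact .inl (.inr (torusGen_mem n false i))
  | K' i =>
    have := torusGen_mem n true (thIdx n i)
    rw [torusGen, if_pos rfl, thIdx_thIdx] at this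
    exact .inl (.inr this)
  | Kinv i => exact .inl (.inr (torusGen_inv_mem n false i))
  | K'inv i =>
    have := torusGen_inv_mem n true (thIdx n i)
    rw [torusGen, if_pos rfl, thIdx_thIdx] at this
    exact .inl (.inr this)

lemma adjoin_DDgen : adjoin Kq (Set.range (DDgen n)) = ⊤ := by
  have h : Set.range (DDgen n) = RingQuot.mkAlgHom Kq (DDRel n) '' Set.range (FreeAlgebra.ι Kq) :=
    Set.range_comp _ _
  rw [h, ← AlgHom.map_adjoin, FreeAlgebra.adjoin_range_ι, Algebra.map_top,
    AlgHom.range_eq_top]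
  exact RingQuot.mkAlgHom_surjective Kq _

lemma rootGen_comm_mem (i j : Idx n) :
    rootGen n false i * rootGen n true j - rootGen n true j * rootGen n false i
      ∈ adjoin Kq (torusSet n) := by
  have h := RingQuot.mkAlgHom_rel Kq (DDRel.EF i (thIdx n j))
  simp only [map_mul, map_add, map_sub, map_smul, mkAlgHom_ddg] at h
  have h' : rootGen n false i * rootGen n true j = rootGen n true j * rootGen n false i + _ := h
  rw [h', add_sub_cancel_left]
  refine Subalgebra.smul_mem _ (sub_mem ?_ ?_) _
  · exact subset_adjoin (torusGen_mem n false i)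
  · have := torusGen_mem n true (thIdx n i)
    rw [torusGen, if_pos rfl, thIdx_thIdx] at this
    exact subset_adjoin this

lemma DDalg_triangular : Subalgebra.toSubmodule (adjoin Kq (Set.range (rootSeq n true)))
    * Subalgebra.toSubmodule (adjoin Kq (torusSet n))
    * Subalgebra.toSubmodule (adjoin Kq (Set.range (rootSeq n false))) = ⊤ := by
  refine triangular_decomposition ?_ ?_ ?_ ?_
  · rintro _ ⟨i, rfl⟩ _ ⟨j, rfl⟩
    rcases lt_or_ge i n with hi | hi
    · rcases lt_or_ge j n with hj | hj
      · rw [rootSeq_of_lt n _ hi, rootSeq_of_lt n _ hj]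
        exact rootGen_comm_mem n _ _
      · simp [rootSeq_of_le n _ hj]
    · simp [rootSeq_of_le n _ hi]
  · rintro _ ⟨i, rfl⟩ _ ⟨b, t, -, rfl | rfl⟩ <;>
      obtain ⟨c, hc, h⟩ := torusSeq_rootSeq n b false t i
    · exact ⟨c⁻¹, units_qcomm hc h⟩
    · exact ⟨c, units_inv_qcomm h⟩
  · rintro _ ⟨b, t, -, rfl | rfl⟩ _ ⟨i, rfl⟩ <;>
      obtain ⟨c, hc, h⟩ := torusSeq_rootSeq n b true t i
    · exact ⟨c, h⟩
    · exact ⟨c⁻¹, units_inv_qcomm' hc h⟩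
  · refine top_unique ((adjoin_DDgen n).symm.le.trans (adjoin_mono ?_))
    rintro _ ⟨g, rfl⟩
    exact DDgen_mem n g

/-- The factors of the Poincaré–Birkhoff–Witt decomposition. -/
def leadSpan : Bool × ((ℕ × ℕ) ⊕ ℕ) → Submodule Kq (DDalg n)
  | (b, .inl p) => powSpan Kq (rootVec qq (rootSeq n b) p.1 p.2)
  | (b, .inr i) => zpowSpan Kq (torusSeq n b i)

lemma adjoin_rootSeq_le (b : Bool) :
    Subalgebra.toSubmodule (adjoin Kq (Set.range (rootSeq n b)))
      ≤ (((rootIdx n n).map fun p =>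
          ((b, .inl p) : Bool × ((ℕ × ℕ) ⊕ ℕ))).map (leadSpan n)).prod := by
  have h := (isSerreSeq_rootSeq n b).adjoin_le_prod qq_ne_zero qq_add_inv_ne_zero
    (fun i hi => rootSeq_of_le n b hi) n le_rfl
  rw [Nat.sub_self, ← bot_eq_zero, Set.Ici_bot, Set.image_univ] at h
  rwa [List.map_map]

/-- The indices of the torus part in `leadIdx`. -/
def torusIdx : List (Bool × ((ℕ × ℕ) ⊕ ℕ)) :=
  (List.range n).map (fun i => (true, .inr i)) ++ (List.range n).map (fun i => (false, .inr i))

lemma adjoin_torusSet_le : Subalgebra.toSubmodule (adjoin Kq (torusSet n))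
    ≤ ((torusIdx n).map (leadSpan n)).prod := by
  have hL : ∀ S ∈ (torusIdx n).map (leadSpan n),
      ∃ (b : Bool) (t : ℕ), S = zpowSpan Kq (torusSeq n b t) := by
    intro S hS
    obtain ⟨s, hs, rfl⟩ := List.mem_map.1 hS
    rcases List.mem_append.1 hs with hs | hs <;> obtain ⟨t, -, rfl⟩ := List.mem_map.1 hs
    · exact ⟨true, t, rfl⟩
    · exact ⟨false, t, rfl⟩
  obtain ⟨h1, h2, h3⟩ := list_prod_closed _ (fun S hS => by
      obtain ⟨b, t, rfl⟩ := hL S hS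
      exact one_le_zpowSpan _) (fun S hS => by
      obtain ⟨b, t, rfl⟩ := hL S hS
      exact zpowSpan_mul_self _) (List.pairwise_of_forall_mem_list fun S hS S' hS' => by
      obtain ⟨b, t, rfl⟩ := hL S hS
      obtain ⟨b', t', rfl⟩ := hL S' hS'
      exact zpowSpan_comm (torusSeq_comm n _ _ _ _))
  refine adjoin_le_of_closed ?_ h1 h2
  have hmem : ∀ (b : Bool) (t : ℕ), t < n → zpowSpan Kq (torusSeq n b t) ∈
      (torusIdx n).map (leadSpan n) := by
    intro b t ht
    refine List.mem_map.2 ⟨(b, .inr t), List.mem_append.2 ?_, rfl⟩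
    cases b
    · exact .inr (List.mem_map.2 ⟨t, List.mem_range.2 ht, rfl⟩)
    · exact .inl (List.mem_map.2 ⟨t, List.mem_range.2 ht, rfl⟩)
  rintro _ ⟨b, t, ht, rfl | rfl⟩
  · exact h3 _ (hmem b t ht) (mem_zpowSpan _)
  · exact h3 _ (hmem b t ht) (inv_mem_zpowSpan _)

lemma prod_leadSpan : ((leadIdx n).map (leadSpan n)).prod = ⊤ := by
  rw [_root_.eq_top_iff, ← DDalg_triangular n, leadIdx, List.map_append,
    List.map_append, List.prod_append, List.prod_append]
  exact mul_le_mul' (mul_le_mul' (adjoin_rootSeq_le n _) (adjoin_torusSet_le n))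
    (adjoin_rootSeq_le n _)

end DoubleGenerators

section Injectivity

lemma map_rootVec {k A A' : Type*} [Field k] [Ring A] [Algebra k A] [Ring A'] [Algebra k A']
    (g : A →ₐ[k] A') (q : k) (e : ℕ → A) (j t : ℕ) :
    g (rootVec q e j t) = rootVec q (fun i => g (e i)) j t := by
  induction t with
  | zero => rfl
  | succ t ih => simp only [rootVec, map_sub, map_mul, map_smul, ih]

variable {n : ℕ}

/-- The exponents of `w_i^r` (for `b = false`) and `m_i^r` (for `b = true`). -/
def termExp (n : ℕ) (b : Bool) (i r : ℤ) : DnLabel → ℤ :=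
  if b then rotHom n (rowExp i r) else rowExp i r

lemma termExp_lt_termExp (b : Bool) {i r s : ℤ} (hr : -i ≤ r) (hrs : r < s) :
    termExp n b i r < termExp n b i s := by
  cases b
  · exact rowExp_lt_rowExp hr hrs
  · exact rotHom_lt (rowExp_lt_rowExp hr hrs)

lemma quiverForm_termExp (b : Bool) (i r j s : ℤ) :
    quiverForm n (termExp n b i r) (termExp n b j s) = quiverForm n (rowExp i r) (rowExp j s) := by
  cases b
  · rfl
  · exact quiverForm_rotHom n _ _

lemma sum_termExp (b : Bool) (p : ℕ × ℕ) :
    ∑ i ∈ Finset.range (p.2 + 1), termExp n b ((p.1 + i : ℕ) + 1) p.1 = lead n (b, .inl p) := by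
  cases b
  · rfl
  · exact (map_sum (rotHom n) _ _).symm

lemma torusHom_ww {i r : ℤ} (hi : 1 ≤ i) (hin : i ≤ n) (hr : r ≤ i) :
    ∃ c : Kq, c ≠ 0 ∧ torusHom n (ww n i r)
      = c • torusOp qq (quiverForm n) (termExp n false i r) := by
  obtain ⟨c, hc, h⟩ := torusHom_Vprod hi hin hr
  refine ⟨ii * qq ^ (i + r) * c,
    mul_ne_zero (mul_ne_zero ii_ne_zero (zpow_ne_zero _ qq_ne_zero)) hc, ?_⟩
  rw [ww, map_smul, h, smul_smul]
  rfl

lemma torusHom_mm {i r : ℤ} (hi : 1 ≤ i) (hin : i ≤ n) (hr : r ≤ i) :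
    ∃ c : Kq, c ≠ 0 ∧ torusHom n (mm n i r)
      = c • torusOp qq (quiverForm n) (termExp n true i r) := by
  obtain ⟨c, hc, h⟩ := torusHom_Lprod hi hin hr
  refine ⟨ii * qq ^ (i + r) * c,
    mul_ne_zero (mul_ne_zero ii_ne_zero (zpow_ne_zero _ qq_ne_zero)) hc, ?_⟩
  rw [mm, map_smul, h, smul_smul]
  rfl

variable {f : DDalg n →ₐ[Kq] Dtorus n}

lemma torusHom_rootSeq (hf : iotaSpec n f) (b : Bool) : ∃ c : ℕ → ℤ → Kq, (∀ t r, c t r ≠ 0) ∧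
    ∀ t < n, torusHom n (f (rootSeq n b t)) = ∑ r ∈ Finset.Icc (-((t : ℤ) + 1)) t,
      c t r • torusOp qq (quiverForm n) (termExp n b ((t : ℤ) + 1) r) := by
  have key : ∀ (t : ℕ) (r : ℤ), ∃ c : Kq, c ≠ 0 ∧ (t < n → r ≤ t →
      torusHom n (if b then mm n ((t : ℤ) + 1) r else ww n ((t : ℤ) + 1) r)
        = c • torusOp qq (quiverForm n) (termExp n b ((t : ℤ) + 1) r)) := by
    intro t r
    by_cases h : t < n ∧ r ≤ t
    · obtain ⟨c, hc, h⟩ : ∃ c : Kq, c ≠ 0 ∧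
          torusHom n (if b then mm n ((t : ℤ) + 1) r else ww n ((t : ℤ) + 1) r)
            = c • torusOp qq (quiverForm n) (termExp n b ((t : ℤ) + 1) r) := by
        cases b
        · exact torusHom_ww (by omega) (by omega) (by omega)
        · exact torusHom_mm (by omega) (by omega) (by omega)
      exact ⟨c, hc, fun _ _ => h⟩
    · exact ⟨1, one_ne_zero, fun h1 h2 => absurd ⟨h1, h2⟩ h⟩
  choose c hc h using key
  refine ⟨c, hc, fun t ht => ?_⟩
  have hE : f (rootSeq n b t) = ∑ r ∈ Finset.Icc (-((t : ℤ) + 1)) t,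
      if b then mm n ((t : ℤ) + 1) r else ww n ((t : ℤ) + 1) r := by
    obtain ⟨h1, -, h3, -⟩ := hf (idxSucc n ht)
    rw [rootSeq_of_lt n b ht]
    simp only [idxSucc, add_sub_cancel_right] at h1 h3
    cases b
    · exact h1
    · exact h3
  rw [hE, map_sum]
  exact Finset.sum_congr rfl fun r hr => h t r ht (Finset.mem_Icc.1 hr).2

lemma torusHom_torusSeq (hf : iotaSpec n f) (b : Bool) {t : ℕ} (ht : t < n) :
    ∃ c : Kq, c ≠ 0 ∧ torusHom n (f (torusSeq n b t))
      = c • torusOp qq (quiverForm n) (lead n (b, .inr t)) := by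
  obtain ⟨-, h2, -, h4, -⟩ := hf (idxSucc n ht)
  have hq : qq ^ (2 * ((t : ℤ) + 1)) ≠ 0 := zpow_ne_zero _ qq_ne_zero
  rw [torusSeq_of_lt n b ht]
  cases b
  · obtain ⟨c, hc, h⟩ := torusHom_Vprod (n := n) (i := (t : ℤ) + 1) (by omega) (by omega) le_rfl
    refine ⟨_, mul_ne_zero hq hc, ?_⟩
    rw [← smul_smul]
    refine (congrArg (torusHom n) h2).trans ?_
    rw [map_smul]
    exact congrArg _ h
  · obtain ⟨c, hc, h⟩ := torusHom_Lprod (n := n) (i := (t : ℤ) + 1) (by omega) (by omega) le_rfl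
    refine ⟨_, mul_ne_zero hq hc, ?_⟩
    rw [← smul_smul]
    refine (congrArg (torusHom n) h4).trans ?_
    rw [map_smul]
    exact congrArg _ h

lemma hasLeadExp_rootSeq (hf : iotaSpec n f) (b : Bool) {p : ℕ × ℕ} (hp : p.1 + p.2 < n) :
    HasLeadExp Kq (torusOp qq (quiverForm n))
      (torusHom n (f (rootVec qq (rootSeq n b) p.1 p.2))) (lead n (b, .inl p)) := by
  obtain ⟨c, hc, h⟩ := torusHom_rootSeq hf b
  have key := hasLeadExp_rootVec (isTorusRep_torusOp qq_ne_zero) qq_ne_zero qq_mul_qq_ne_one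
    (W := fun t r => termExp n b ((t : ℤ) + 1) r) hc h
    (fun t _ r s hr hrs _ => termExp_lt_termExp b hr hrs)
    (fun t u htu _ r s _ _ _ _ => by
      rw [quiverForm_termExp, quiverForm_termExp, quiverForm_rowExp_far n (by omega),
        quiverForm_rowExp_far n (by omega), sub_self])
    (fun t ht r s hr hr' hrs hs hs' => by
      rw [quiverForm_termExp, quiverForm_termExp]
      push_cast
      exact quiverForm_rowExp_succ_pos n (by omega) (by omega) hr (by omega) hs' hrs)
    (fun t ht s hs hs' => by
      rw [quiverForm_termExp, quiverForm_termExp]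
      push_cast
      exact quiverForm_rowExp_succ_neg n (by omega) (by omega) (by omega) hs)
    p.1 p.2 hp
  have e := map_rootVec (A := DDalg n) (A' := Module.End Kq ((DnLabel → ℤ) →₀ Kq))
    ((torusHom n).comp f) qq (rootSeq n b) p.1 p.2
  rw [← sum_termExp]
  exact (congrArg (fun y => HasLeadExp Kq (torusOp qq (quiverForm n)) y _) e).mpr key

lemma hasLeadBasis_leadSpan (hf : iotaSpec n f) {s : Bool × ((ℕ × ℕ) ⊕ ℕ)}
    (hs : halfValid n s.2) : HasLeadBasis (torusOp qq (quiverForm n)) ((torusHom n).comp f)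
      (leadSpan n s) (AddSubgroup.zmultiples (lead n s)) := by
  have hX := isTorusRep_torusOp (B := quiverForm n) qq_ne_zero
  have hl := leadFun_lead_self_ne_zero n s
  obtain ⟨b, p | i⟩ := s
  · exact hasLeadBasis_powSpan hX qq_ne_zero (hasLeadExp_rootSeq hf b hs) _ hl
  · obtain ⟨c, hc, h⟩ := torusHom_torusSeq hf b hs
    exact hasLeadBasis_zpowSpan hX qq_ne_zero hc h _ hl

theorem injective_of_iotaSpec (hf : iotaSpec n f) : Function.Injective f := by
  have hX := isTorusRep_torusOp (B := quiverForm n) qq_ne_zero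
  have hS : ∀ s ∈ leadIdx n, HasLeadBasis (torusOp qq (quiverForm n)) ((torusHom n).comp f)
      (leadSpan n s) (AddSubgroup.zmultiples (lead n s)) :=
    fun s hs => hasLeadBasis_leadSpan hf (halfValid_of_mem_leadIdx hs)
  have h := hasLeadBasis_list_prod hX qq_ne_zero (leadIdx n) hS
    (fun s _ => leadFun_lead_self_ne_zero n s) (pairwise_leadIdx n)
  rw [prod_leadSpan] at h
  exact Function.Injective.of_comp (f := torusHom n) (h.injective hX)

end Injectivity

/-- The `𝕂`-algebra homomorphism `ι : 𝔇ₙ → 𝒟ₙ` defined by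
`ι(E_i) = Σ_{r=−i}^{i−1} w_i^r`, `ι(F_{θ(i)}) = Σ_{r=−i}^{i−1} m_i^r`,
`ι(K_i) = q^{2i} X_{V_{i,−i}} ⋯ X_{V_{i,i}}`, `ι(K'_{θ(i)}) = q^{2i} X_{Λ_{i,−i}} ⋯ X_{Λ_{i,i}}`
is injective. -/
theorem statement2 (n : ℕ) (hn : 1 ≤ n) (f : DDalg n →ₐ[Kq] Dtorus n) (hf : iotaSpec n f) :
    Function.Injective f := by
  exact injective_of_iotaSpec hf

end
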